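/- There exist constants ε₀ > 0 and C > 0 depending only on k such that the following holds. Let 0 < ε ≤ ε₀, let μ be an ε-product probability measure on V = V₁×⋯×V_k, let d ≤ k, and let f : V → ℝ. Then ‖f^{≤d}‖₄⁴ ≤ 20^d · Σ_{S⊆[k], |S|≤d} (4d)^{|S|} · E_{x∼μ_S}[(I^{≤d}_{S,x}[f])²] + C·ε·‖f‖₂²·‖f‖_∞². -/

import Mathlib

open Finset

namespace GLL

variable {k : ℕ} {V : Fin k → Type} [∀ i, Fintype (V i)] [∀ i, DecidableEq (V i)]

/-- Expectation of `f` with respect to the (finitely supported) measure `μ`. -/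
def expect (μ f : (∀ i, V i) → ℝ) : ℝ := ∑ x, μ x * f x

/-- `μ` is a probability measure. -/
def IsProb (μ : (∀ i, V i) → ℝ) : Prop := (∀ x, 0 ≤ μ x) ∧ ∑ x, μ x = 1

/-- The marginal `μ_S` evaluated at (the `S`-coordinates of) `x`. -/
def marg (μ : (∀ i, V i) → ℝ) (S : Finset (Fin k)) (x : ∀ i, V i) : ℝ :=
  ∑ z, if ∀ i ∈ S, z i = x i then μ z else 0

/-- The link (conditional) measure `μ_x` for `x ∈ V_S`, viewed as a measure on
full points agreeing with `x` on `S`. -/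
noncomputable def cond (μ : (∀ i, V i) → ℝ) (S : Finset (Fin k)) (x z : ∀ i, V i) : ℝ :=
  if ∀ i ∈ S, z i = x i then μ z / marg μ S x else 0

/-- The averaging operator `A_S`: `A_S f (x) = E_{y ∼ μ_{x_S}} [f(x_S, y)]`.
Applied to an `S'`-junta `f`, this is also the operator `A_{S',S}`. -/
noncomputable def Aop (μ : (∀ i, V i) → ℝ) (S : Finset (Fin k)) (f : (∀ i, V i) → ℝ)
    (x : ∀ i, V i) : ℝ :=
  ∑ z, cond μ S x z * f z

/-- The Efron–Stein component `f^{=S} = ∑_{T ⊆ S} (-1)^{|S∖T|} A_T f`. -/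
noncomputable def ES (μ : (∀ i, V i) → ℝ) (S : Finset (Fin k)) (f : (∀ i, V i) → ℝ)
    (x : ∀ i, V i) : ℝ :=
  ∑ T ∈ S.powerset, (-1 : ℝ) ^ (S.card - T.card) * Aop μ T f x

/-- The low-degree part `f^{≤ d} = ∑_{|S| ≤ d} f^{=S}`. -/
noncomputable def lowPart (μ : (∀ i, V i) → ℝ) (d : ℕ) (f : (∀ i, V i) → ℝ)
    (x : ∀ i, V i) : ℝ :=
  ∑ S ∈ univ.powerset.filter (fun S : Finset (Fin k) => S.card ≤ d), ES μ S f x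

/-- The Laplacian `L_S[f] = ∑_{T ⊇ S} f^{=T}`. -/
noncomputable def Lap (μ : (∀ i, V i) → ℝ) (S : Finset (Fin k)) (f : (∀ i, V i) → ℝ)
    (x : ∀ i, V i) : ℝ :=
  ∑ T ∈ univ.powerset.filter (fun T : Finset (Fin k) => S ⊆ T), ES μ T f x

/-- The truncated Laplacian `L_S^{≤d}[f] = ∑_{T ⊇ S, |T| ≤ d} f^{=T}`. -/
noncomputable def LapLe (μ : (∀ i, V i) → ℝ) (d : ℕ) (S : Finset (Fin k))
    (f : (∀ i, V i) → ℝ) (x : ∀ i, V i) : ℝ :=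
  ∑ T ∈ univ.powerset.filter (fun T : Finset (Fin k) => S ⊆ T ∧ T.card ≤ d), ES μ T f x

/-- The influence `I_{S,x}[f] = ‖L_S[f](x,·)‖²_{L²(μ_x)}`. -/
noncomputable def Inf (μ : (∀ i, V i) → ℝ) (S : Finset (Fin k)) (f : (∀ i, V i) → ℝ)
    (x : ∀ i, V i) : ℝ :=
  ∑ z, cond μ S x z * (Lap μ S f z) ^ 2

/-- The truncated influence `I^{≤d}_{S,x}[f] = ‖L_S^{≤d}[f](x,·)‖²_{L²(μ_x)}`. -/
noncomputable def InfLe (μ : (∀ i, V i) → ℝ) (d : ℕ) (S : Finset (Fin k))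
    (f : (∀ i, V i) → ℝ) (x : ∀ i, V i) : ℝ :=
  ∑ z, cond μ S x z * (LapLe μ d S f z) ^ 2

/-- `‖f‖₂²` with respect to `μ`. -/
def normSq (μ f : (∀ i, V i) → ℝ) : ℝ := ∑ x, μ x * (f x) ^ 2

/-- `‖f‖₄⁴` with respect to `μ`. -/
def norm4p4 (μ f : (∀ i, V i) → ℝ) : ℝ := ∑ x, μ x * (f x) ^ 4

/-- `‖f‖₂` with respect to `μ`. -/
noncomputable def l2norm (μ f : (∀ i, V i) → ℝ) : ℝ := Real.sqrt (normSq μ f)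

/-- `‖f‖_∞`: the maximum of `|f|` over the support of `μ`. -/
noncomputable def supNorm (μ f : (∀ i, V i) → ℝ) : ℝ :=
  sSup ((fun x => |f x|) '' {x | 0 < μ x})

/-- Inner product `⟨f, g⟩ = E_{x∼μ}[f(x) g(x)]`. -/
def inner' (μ f g : (∀ i, V i) → ℝ) : ℝ := ∑ x, μ x * (f x * g x)

/-- The pair `{i,j}`-skeleton of `μ` is `ε`-pseudorandom. -/
def PairPseudo (μ : (∀ i, V i) → ℝ) (ε : ℝ) (i j : Fin k) : Prop :=
  ∀ (f₁ : V i → ℝ) (f₂ : V j → ℝ),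
    |expect μ (fun x => f₁ (x i) * f₂ (x j)) -
        expect μ (fun x => f₁ (x i)) * expect μ (fun x => f₂ (x j))| ≤
      ε * Real.sqrt
        ((expect μ (fun x => f₁ (x i) ^ 2) - expect μ (fun x => f₁ (x i)) ^ 2) *
          (expect μ (fun x => f₂ (x j) ^ 2) - expect μ (fun x => f₂ (x j)) ^ 2))

/-- `μ` is an `ε`-product measure: every link of every restriction of size `≤ k - 2`
has `ε`-pseudorandom skeletons. -/
def EpsProduct (μ : (∀ i, V i) → ℝ) (ε : ℝ) : Prop :=
  ∀ S : Finset (Fin k), S.card ≤ k - 2 → ∀ x, 0 < marg μ S x →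
    ∀ i j : Fin k, i ∉ S → j ∉ S → i ≠ j → PairPseudo (cond μ S x) ε i j

/-- `‖f(x,·)‖_{L²(μ_x)}` for `x ∈ V_S`. -/
noncomputable def restrictNorm (μ : (∀ i, V i) → ℝ) (S : Finset (Fin k)) (x : ∀ i, V i)
    (f : (∀ i, V i) → ℝ) : ℝ :=
  Real.sqrt (∑ z, cond μ S x z * (f z) ^ 2)

/-- `f` is `(d, δ)`-global: all restrictions of at most `d` coordinates have
`2`-norm at most `δ`. -/
def IsGlobal (μ : (∀ i, V i) → ℝ) (d : ℕ) (δ : ℝ) (f : (∀ i, V i) → ℝ) : Prop :=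
  ∀ S : Finset (Fin k), S.card ≤ d → ∀ x, 0 < marg μ S x → restrictNorm μ S x f ≤ δ

/-- `f` is an `S`-junta: it depends only on the coordinates in `S`. -/
def Junta (S : Finset (Fin k)) (f : (∀ i, V i) → ℝ) : Prop :=
  ∀ x y, (∀ i ∈ S, x i = y i) → f x = f y

/-- The noise operator `T_ρ f = ∑_{S ⊆ [k]} ρ^{|S|} (1-ρ)^{k-|S|} A_S f`. -/
noncomputable def noiseOp (μ : (∀ i, V i) → ℝ) (ρ : ℝ) (f : (∀ i, V i) → ℝ)
    (x : ∀ i, V i) : ℝ :=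
  ∑ S ∈ (univ : Finset (Fin k)).powerset, ρ ^ S.card * (1 - ρ) ^ (k - S.card) * Aop μ S f x

/-- The up-down walk operator `T = (1/k) ∑_{i=1}^k A_{[k]∖{i}}`. -/
noncomputable def upDown (μ : (∀ i, V i) → ℝ) (f : (∀ i, V i) → ℝ) (x : ∀ i, V i) : ℝ :=
  (1 / (k : ℝ)) * ∑ i : Fin k, Aop μ (univ.erase i) f x

/-- The product measure `μ₁ ⊗ ⋯ ⊗ μ_k`. -/
def prodMeasure (μi : ∀ i, V i → ℝ) : (∀ i, V i) → ℝ := fun x => ∏ i, μi i (x i)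

/-- `f` has degree at most `d`: `f^{=S} = 0` whenever `|S| > d`. -/
def DegLe (μ : (∀ i, V i) → ℝ) (d : ℕ) (f : (∀ i, V i) → ℝ) : Prop :=
  ∀ S : Finset (Fin k), d < S.card → ∀ x, ES μ S f x = 0

/-- `{F S}_{S ⊆ [k]}` is an `(α, ε')`-approximate Efron–Stein decomposition of `f`. -/
noncomputable def ApproxES (μ : (∀ i, V i) → ℝ) (α ε' : ℝ) (f : (∀ i, V i) → ℝ)
    (F : Finset (Fin k) → (∀ i, V i) → ℝ) : Prop :=
  l2norm μ f ≤ α ∧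
    l2norm μ (fun x => f x - ∑ S ∈ (univ : Finset (Fin k)).powerset, F S x) ≤ ε' ∧
    ∀ S : Finset (Fin k), ∃ h : (∀ i, V i) → ℝ,
      l2norm μ h ≤ α ∧ l2norm μ (fun x => ES μ S h x - F S x) ≤ ε'

/-- A finite probability space with a commuting-up-to-inclusion family of conditional
expectations `A S`, indexed by the subsets of `ι`. -/
structure AveragingSystem (ι Ω : Type*) [Fintype ι] [DecidableEq ι] [Fintype Ω] where
  w : Ω → ℝ
  w_nonneg : ∀ x, 0 ≤ w x
  A : Finset ι → (Ω → ℝ) →ₗ[ℝ] (Ω → ℝ)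
  symm : ∀ S u v, ∑ x, w x * (u x * A S v x) = ∑ x, w x * (A S u x * v x)
  nonneg : ∀ S u, 0 ≤ u → 0 ≤ A S u
  one : ∀ S, A S 1 = 1
  comp_of_subset : ∀ S T, S ⊆ T → ∀ v, A S (A T v) = A S v
  comp_of_superset : ∀ S T, S ⊆ T → ∀ v, A T (A S v) = A S v
  pull_out : ∀ S u v, A S (A S u * v) = A S u * A S v
  univ_apply : ∀ v, A univ v = v

namespace AveragingSystem

variable {ι Ω : Type*} [Fintype ι] [DecidableEq ι] [Fintype Ω] (P : AveragingSystem ι Ω)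

/-- Expectation as a linear functional. -/
noncomputable def E : (Ω → ℝ) →ₗ[ℝ] ℝ := ∑ x, P.w x • LinearMap.proj x

lemma E_apply (u : Ω → ℝ) : P.E u = ∑ x, P.w x * u x := by
  simp [E]

lemma E_mono {u v : Ω → ℝ} (h : u ≤ v) : P.E u ≤ P.E v := by
  rw [E_apply, E_apply]
  exact sum_le_sum fun x _ => mul_le_mul_of_nonneg_left (h x) (P.w_nonneg x)

lemma E_nonneg {u : Ω → ℝ} (h : 0 ≤ u) : 0 ≤ P.E u := by
  simpa using P.E_mono h

/-- The isometric embedding of `L²(w)` in a Euclidean space. -/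
noncomputable def emb : (Ω → ℝ) →ₗ[ℝ] EuclideanSpace ℝ Ω where
  toFun u := WithLp.toLp 2 fun x => √(P.w x) * u x
  map_add' u v := by ext x; simp [mul_add]
  map_smul' c u := by ext x; simp; ring

/-- The norm of `L²(w)`. -/
noncomputable def nrm (u : Ω → ℝ) : ℝ := ‖P.emb u‖

lemma inner_emb (u v : Ω → ℝ) : inner ℝ (P.emb u) (P.emb v) = P.E (u * v) := by
  simp only [emb, LinearMap.coe_mk, AddHom.coe_mk, PiLp.inner_apply, E_apply]
  refine sum_congr rfl fun x _ => ?_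
  have := Real.mul_self_sqrt (P.w_nonneg x)
  simp only [RCLike.inner_apply, conj_trivial, Pi.mul_apply]
  linear_combination (u x * v x) * this

lemma nrm_sq (u : Ω → ℝ) : P.nrm u ^ 2 = P.E (u * u) := by
  rw [nrm, ← inner_emb, real_inner_self_eq_norm_sq]

lemma nrm_nonneg (u : Ω → ℝ) : 0 ≤ P.nrm u := norm_nonneg _

lemma abs_E_mul_le (u v : Ω → ℝ) : |P.E (u * v)| ≤ P.nrm u * P.nrm v := by
  rw [← inner_emb]
  exact abs_real_inner_le_norm _ _

lemma E_mul_le (u v : Ω → ℝ) : P.E (u * v) ≤ P.nrm u * P.nrm v :=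
  (le_abs_self _).trans (P.abs_E_mul_le u v)

lemma nrm_add_le (u v : Ω → ℝ) : P.nrm (u + v) ≤ P.nrm u + P.nrm v := by
  simpa [nrm] using norm_add_le (P.emb u) (P.emb v)

lemma nrm_smul (c : ℝ) (u : Ω → ℝ) : P.nrm (c • u) = |c| * P.nrm u := by
  simp [nrm, _root_.norm_smul]

lemma nrm_sum_le {α : Type*} (s : Finset α) (u : α → Ω → ℝ) :
    P.nrm (∑ a ∈ s, u a) ≤ ∑ a ∈ s, P.nrm (u a) := by
  simpa [nrm] using norm_sum_le s fun a => P.emb (u a)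

lemma nrm_sum_le_of_le {α : Type*} (s : Finset α) (u : α → Ω → ℝ) {c m : ℝ} (hc : 0 ≤ c)
    (hs : (s.card : ℝ) ≤ m) (h : ∀ a ∈ s, P.nrm (u a) ≤ c) :
    P.nrm (∑ a ∈ s, u a) ≤ m * c := by
  refine (P.nrm_sum_le s u).trans ((sum_le_card_nsmul s _ c h).trans ?_)
  rw [nsmul_eq_mul]
  gcongr

lemma nrm_le_of_abs_le {u v : Ω → ℝ} (h : ∀ x, |u x| ≤ |v x|) : P.nrm u ≤ P.nrm v := by
  refine le_of_sq_le_sq ?_ (P.nrm_nonneg v)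
  rw [nrm_sq, nrm_sq]
  exact P.E_mono fun x => by simpa [← sq] using sq_le_sq.2 (h x)

lemma nrm_mul_le {u : Ω → ℝ} (v : Ω → ℝ) {M : ℝ} (hM : 0 ≤ M) (h : ∀ x, |u x| ≤ M) :
    P.nrm (u * v) ≤ M * P.nrm v := by
  rw [← abs_of_nonneg hM, ← nrm_smul]
  refine P.nrm_le_of_abs_le fun x => ?_
  simp only [Pi.mul_apply, Pi.smul_apply, smul_eq_mul, abs_mul, abs_of_nonneg hM]
  exact mul_le_mul_of_nonneg_right (h x) (abs_nonneg _)

lemma E_mul_A (S : Finset ι) (u v : Ω → ℝ) : P.E (u * P.A S v) = P.E (P.A S u * v) := by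
  simpa only [E_apply, Pi.mul_apply] using P.symm S u v

lemma A_comp_self (S : Finset ι) (v : Ω → ℝ) : P.A S (P.A S v) = P.A S v :=
  P.comp_of_subset S S subset_rfl v

lemma E_A_mul_A (S : Finset ι) (u v : Ω → ℝ) : P.E (P.A S u * P.A S v) = P.E (u * P.A S v) := by
  rw [← E_mul_A, A_comp_self]

lemma nrm_A_le (S : Finset ι) (u : Ω → ℝ) : P.nrm (P.A S u) ≤ P.nrm u := by
  have h := P.E_mul_le u (P.A S u)
  rw [← E_A_mul_A, ← nrm_sq] at h
  nlinarith [P.nrm_nonneg u, P.nrm_nonneg (P.A S u)]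

lemma A_mono (S : Finset ι) {u v : Ω → ℝ} (h : u ≤ v) : P.A S u ≤ P.A S v := by
  have := P.nonneg S (v - u) (sub_nonneg.2 h)
  rwa [map_sub, sub_nonneg] at this

lemma abs_A_le (S : Finset ι) {u : Ω → ℝ} {M : ℝ} (h : ∀ x, |u x| ≤ M) (x : Ω) :
    |P.A S u x| ≤ M := by
  have h1 : P.A S (M • 1) = M • 1 := by rw [map_smul, P.one]
  have h2 := P.A_mono S (u := u) (v := M • 1) (fun y => by simpa using (abs_le.1 (h y)).2) x
  have h3 := P.A_mono S (u := -(M • 1)) (v := u) (fun y => by simpa using (abs_le.1 (h y)).1) x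
  rw [map_neg] at h3
  rw [h1] at h2 h3
  simp at h2 h3
  exact abs_le.2 ⟨h3, h2⟩

/-- Functions measurable with respect to the coordinates in `S`. -/
def Meas (S : Finset ι) (u : Ω → ℝ) : Prop := P.A S u = u

variable {P}

lemma Meas.A_mul {S : Finset ι} {u : Ω → ℝ} (hu : P.Meas S u) (v : Ω → ℝ) :
    P.A S (u * v) = u * P.A S v := by
  have := P.pull_out S u v
  rwa [hu] at this

lemma Meas.mul {S : Finset ι} {u v : Ω → ℝ} (hu : P.Meas S u) (hv : P.Meas S v) :
    P.Meas S (u * v) := by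
  rw [Meas, hu.A_mul, hv]

lemma Meas.mono {S T : Finset ι} (h : S ⊆ T) {u : Ω → ℝ} (hu : P.Meas S u) : P.Meas T u := by
  rw [Meas, ← hu, P.comp_of_superset S T h]

variable (P)

/-- Cauchy-Schwarz for `A S`, pointwise. -/
lemma A_sum_mul_sq_le {α : Type*} (S : Finset ι) (s : Finset α) (p q : α → Ω → ℝ) (x : Ω) :
    (P.A S (∑ a ∈ s, p a * q a) x) ^ 2 ≤
      (∑ a ∈ s, P.A S (p a * p a)) x * (∑ a ∈ s, P.A S (q a * q a)) x := by
  have key : ∀ t : ℝ, 0 ≤ (∑ a ∈ s, P.A S (p a * p a)) x * (t * t) +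
      (2 * P.A S (∑ a ∈ s, p a * q a) x) * t + (∑ a ∈ s, P.A S (q a * q a)) x := by
    intro t
    have h := P.nonneg S (∑ a ∈ s, (t • p a + q a) * (t • p a + q a))
      (sum_nonneg fun a _ => fun y => mul_self_nonneg _) x
    have e : ∑ a ∈ s, (t • p a + q a) * (t • p a + q a) =
        (t * t) • ∑ a ∈ s, p a * p a + (2 * t) • ∑ a ∈ s, p a * q a + ∑ a ∈ s, q a * q a := by
      simp only [smul_sum, ← sum_add_distrib]
      refine sum_congr rfl fun a _ => ?_
      ext y
      simp
      ring
    rw [e] at h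
    simp only [map_add, map_smul, Pi.add_apply, Pi.smul_apply, smul_eq_mul, Pi.zero_apply,
      map_sum] at h ⊢
    linarith
  have := discrim_le_zero key
  rw [discrim] at this
  linarith

/-- The Efron-Stein component `u^{=S}`. -/
noncomputable def es (S : Finset ι) : (Ω → ℝ) →ₗ[ℝ] (Ω → ℝ) :=
  ∑ T ∈ S.powerset, (-1 : ℝ) ^ (S.card - T.card) • P.A T

lemma es_apply (S : Finset ι) (u : Ω → ℝ) :
    P.es S u = ∑ T ∈ S.powerset, (-1 : ℝ) ^ (S.card - T.card) • P.A T u := by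
  simp [es]

lemma es_A (S : Finset ι) (u : Ω → ℝ) : P.es S (P.A S u) = P.es S u := by
  rw [es_apply, es_apply]
  exact sum_congr rfl fun T hT => by rw [P.comp_of_subset T S (mem_powerset.1 hT)]

lemma meas_es (S : Finset ι) (u : Ω → ℝ) : P.Meas S (P.es S u) := by
  rw [Meas, es_apply, map_sum]
  refine sum_congr rfl fun T hT => ?_
  rw [map_smul, P.comp_of_superset T S (mem_powerset.1 hT)]

lemma sum_es (u : Ω → ℝ) : ∑ S, P.es S u = u := by
  have h1 : ∀ S : Finset ι, P.es S u =
      ∑ T, if T ⊆ S then (-1 : ℝ) ^ (S.card - T.card) • P.A T u else 0 := by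
    intro S
    rw [es_apply, ← sum_filter]
    exact sum_congr (by ext; simp) fun _ _ => rfl
  have h2 : ∀ T : Finset ι, ∑ S : Finset ι, (if T ⊆ S then (-1 : ℝ) ^ (S.card - T.card) else 0) =
      if T = univ then 1 else 0 := by
    intro T
    have h3 := Finset.sum_powerset_neg_one_pow_card (x := Tᶜ)
    rw [← sum_filter]
    have h4 : ∑ S ∈ univ.filter (fun S : Finset ι => T ⊆ S), (-1 : ℝ) ^ (S.card - T.card) =
        ∑ S ∈ (Tᶜ).powerset, (-1 : ℝ) ^ S.card := by
      refine sum_nbij' (fun S => S \ T) (fun S => S ∪ T) ?_ ?_ ?_ ?_ ?_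
      · intro S _
        simp only [mem_powerset]
        exact fun i hi => by simp at hi ⊢; exact hi.2
      · intro S _; simp
      · intro S hS
        simp only [mem_filter, mem_univ, true_and] at hS
        exact sdiff_union_of_subset hS
      · intro S hS
        simp only [mem_powerset] at hS
        exact union_sdiff_cancel_right (disjoint_left.2 fun i hi => by simpa using hS hi)
      · intro S hS
        simp only [mem_filter, mem_univ, true_and] at hS
        rw [card_sdiff_of_subset hS]
    rw [h4]
    have h5 := congrArg (Int.cast : ℤ → ℝ) h3
    push_cast at h5
    rw [h5]
    simp [compl_eq_empty_iff]
  simp_rw [h1]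
  rw [sum_comm]
  have h6 : ∀ T : Finset ι, ∑ S : Finset ι,
      (if T ⊆ S then (-1 : ℝ) ^ (S.card - T.card) • P.A T u else 0) =
      if T = univ then P.A T u else 0 := by
    intro T
    have := congrArg (fun c : ℝ => c • P.A T u) (h2 T)
    simp only [sum_smul, ite_smul, zero_smul, one_smul] at this
    exact this
  simp_rw [h6]
  simp [P.univ_apply]

omit [Fintype ι] [Fintype Ω] in
lemma alternating_sum_eq_zero {S : Finset ι} {i : ι} (hi : i ∈ S) (φ : Finset ι → Ω → ℝ)
    (h : ∀ T, i ∉ T → φ (insert i T) = φ T) :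
    ∑ T ∈ S.powerset, (-1 : ℝ) ^ (S.card - T.card) • φ T = 0 := by
  obtain ⟨S, hS, rfl⟩ : ∃ S', i ∉ S' ∧ insert i S' = S := ⟨S.erase i, by simp, insert_erase hi⟩
  rw [sum_powerset_insert hS, ← sum_add_distrib]
  refine sum_eq_zero fun T hT => ?_
  have hT := mem_powerset.1 hT
  have hiT : i ∉ T := fun h => hS (hT h)
  rw [h T hiT, card_insert_of_notMem hS, card_insert_of_notMem hiT,
    Nat.succ_sub (card_le_card hT), Nat.add_sub_add_right, pow_succ]
  simp

/-- The number of subsets of the index type. -/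
noncomputable abbrev K (ι : Type*) [Fintype ι] : ℝ := 2 ^ Fintype.card ι

omit [Fintype Ω] [DecidableEq ι] in
lemma one_le_K : 1 ≤ K ι := one_le_pow₀ (by norm_num)

omit [Fintype Ω] [DecidableEq ι] in
lemma card_le_K (s : Finset (Finset ι)) : (s.card : ℝ) ≤ K ι := by
  have := card_le_univ s
  rw [Fintype.card_finset] at this
  rw [K]
  exact_mod_cast this

lemma nrm_alternating_sum_le (S : Finset ι) (ψ : Finset ι → Ω → ℝ) {c : ℝ} (hc : 0 ≤ c)
    (h : ∀ T ⊆ S, P.nrm (ψ T) ≤ c) :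
    P.nrm (∑ T ∈ S.powerset, (-1 : ℝ) ^ (S.card - T.card) • ψ T) ≤ K ι * c := by
  refine P.nrm_sum_le_of_le _ _ hc (card_le_K _) fun T hT => ?_
  rw [nrm_smul, abs_pow]
  simpa using h T (mem_powerset.1 hT)

lemma nrm_es_le (S : Finset ι) (u : Ω → ℝ) : P.nrm (P.es S u) ≤ K ι * P.nrm u := by
  rw [es_apply]
  exact P.nrm_alternating_sum_le S _ (P.nrm_nonneg u) fun T _ => P.nrm_A_le T u

lemma abs_es_le (S : Finset ι) {u : Ω → ℝ} {M : ℝ} (hM : 0 ≤ M) (h : ∀ x, |u x| ≤ M) (x : Ω) :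
    |P.es S u x| ≤ K ι * M := by
  rw [es_apply, Finset.sum_apply]
  refine (abs_sum_le_sum_abs _ _).trans ((sum_le_card_nsmul _ _ M fun T _ => ?_).trans ?_)
  · simpa [abs_mul, abs_pow] using P.abs_A_le T h x
  · rw [nsmul_eq_mul]
    exact mul_le_mul_of_nonneg_right (card_le_K _) hM

lemma nrm_es_mul_es_le (S T : Finset ι) {f : Ω → ℝ} {M : ℝ} (hM : 0 ≤ M)
    (h : ∀ x, |f x| ≤ M) :
    P.nrm (P.es S f * P.es T f) ≤ K ι ^ 2 * (P.nrm f * M) := by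
  have hK := one_le_K (ι := ι)
  refine (P.nrm_mul_le _ (by positivity) (P.abs_es_le S hM h)).trans ?_
  calc _ ≤ K ι * M * (K ι * P.nrm f) := by gcongr; exact P.nrm_es_le T f
    _ = _ := by ring

/-- The averaging operators are `δ`-close to satisfying `A S ∘ A T = A (S ∩ T)`. -/
def Almost (δ : ℝ) : Prop :=
  ∀ S T v, P.nrm (P.A S (P.A T v) - P.A (S ∩ T) v) ≤ δ * P.nrm v

variable {P} {δ : ℝ} (hP : P.Almost δ) (hδ : 0 ≤ δ)

include hP hδ

lemma nrm_A_es_le {Q S : Finset ι} {i : ι} (hi : i ∈ S) (hQ : i ∉ Q) (u : Ω → ℝ) :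
    P.nrm (P.A Q (P.es S u)) ≤ K ι * (δ * P.nrm u) := by
  have h0 := alternating_sum_eq_zero hi (fun T => P.A (Q ∩ T) u) fun T _ => by
    rw [inter_insert_of_notMem hQ]
  have h1 : P.A Q (P.es S u) =
      ∑ T ∈ S.powerset, (-1 : ℝ) ^ (S.card - T.card) • (P.A Q (P.A T u) - P.A (Q ∩ T) u) := by
    simp only [smul_sub, sum_sub_distrib, h0, es_apply, map_sum, map_smul, sub_zero]
  rw [h1]
  exact P.nrm_alternating_sum_le S _ (mul_nonneg hδ (P.nrm_nonneg u)) fun T _ => hP Q T u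

lemma nrm_es_le_of_meas {U S : Finset ι} (hS : ¬ S ⊆ U) {u : Ω → ℝ} (hu : P.Meas U u) :
    P.nrm (P.es S u) ≤ K ι * (δ * P.nrm u) := by
  obtain ⟨i, hi, hU⟩ := not_subset.1 hS
  have h0 := alternating_sum_eq_zero hi (fun T => P.A (T ∩ U) u) fun T _ => by
    rw [insert_inter_of_notMem hU]
  have h1 : P.es S u =
      ∑ T ∈ S.powerset, (-1 : ℝ) ^ (S.card - T.card) • (P.A T (P.A U u) - P.A (T ∩ U) u) := by
    simp only [smul_sub, sum_sub_distrib, h0, es_apply, sub_zero]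
    rw [hu]
  rw [h1]
  exact P.nrm_alternating_sum_le S _ (mul_nonneg hδ (P.nrm_nonneg u)) fun T _ => hP T U u

lemma nrm_A_es_mul_es_le_of_mem {Q S T : Finset ι} {i : ι} (hS : i ∈ S) (hT : i ∉ T) (hQ : i ∉ Q)
    {f : Ω → ℝ} {M : ℝ} (hM : 0 ≤ M) (h : ∀ x, |f x| ≤ M) :
    P.nrm (P.A Q (P.es S f * P.es T f)) ≤ K ι ^ 2 * (δ * (P.nrm f * M)) := by
  have hK := one_le_K (ι := ι)
  have hm : P.Meas (univ.erase i) (P.es T f) :=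
    (P.meas_es T f).mono fun j hj => by simpa using fun e : j = i => hT (e ▸ hj)
  rw [← P.comp_of_subset Q (univ.erase i)
    (fun j hj => by simpa using fun e : j = i => hQ (e ▸ hj)), mul_comm, hm.A_mul]
  refine (P.nrm_A_le _ _).trans ((P.nrm_mul_le _ (by positivity) (P.abs_es_le T hM h)).trans ?_)
  calc _ ≤ K ι * M * (K ι * (δ * P.nrm f)) := by
        gcongr
        exact nrm_A_es_le hP hδ hS (by simp) f
    _ = _ := by ring

lemma nrm_A_es_mul_es_le {Q S T : Finset ι} (hne : S \ Q ≠ T \ Q)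
    {f : Ω → ℝ} {M : ℝ} (hM : 0 ≤ M) (h : ∀ x, |f x| ≤ M) :
    P.nrm (P.A Q (P.es S f * P.es T f)) ≤ K ι ^ 2 * (δ * (P.nrm f * M)) := by
  obtain ⟨i, hi⟩ : ∃ i, ¬ (i ∈ S \ Q ↔ i ∈ T \ Q) := by
    by_contra! hc
    exact hne (ext hc)
  simp only [mem_sdiff] at hi
  by_cases hS : i ∈ S
  · exact nrm_A_es_mul_es_le_of_mem hP hδ hS (by tauto) (by tauto) hM h
  · rw [mul_comm (P.es S f)]
    exact nrm_A_es_mul_es_le_of_mem hP hδ (i := i) (by tauto) hS (by tauto) hM h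

lemma nrm_es_es_mul_es_le {S T₁ T₂ : Finset ι} (hne : ¬ (T₁ \ S = T₂ \ S ∧ S ⊆ T₁ ∪ T₂))
    {f : Ω → ℝ} {M : ℝ} (hM : 0 ≤ M) (h : ∀ x, |f x| ≤ M) :
    P.nrm (P.es S (P.es T₁ f * P.es T₂ f)) ≤ K ι ^ 3 * (δ * (P.nrm f * M)) := by
  have hK := one_le_K (ι := ι)
  have hf := P.nrm_nonneg f
  by_cases hS : S ⊆ T₁ ∪ T₂
  · rw [es_apply]
    refine (P.nrm_alternating_sum_le S _ (c := K ι ^ 2 * (δ * (P.nrm f * M))) (by positivity)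
      fun T hT => nrm_A_es_mul_es_le hP hδ (fun e => hne ⟨?_, hS⟩) hM h).trans (le_of_eq (by ring))
    have := congrArg (· \ S) e
    simpa only [sdiff_sdiff, sup_eq_union, union_eq_right.2 hT] using this
  · refine (nrm_es_le_of_meas hP hδ hS (((P.meas_es T₁ f).mono subset_union_left).mul
      ((P.meas_es T₂ f).mono subset_union_right))).trans ?_
    calc _ ≤ K ι * (δ * (K ι ^ 2 * (P.nrm f * M))) := by
          gcongr
          exact P.nrm_es_mul_es_le T₁ T₂ hM h
      _ = _ := by ring

lemma abs_E_es_mul_es_le {S T : Finset ι} (hne : S ≠ T) (u v : Ω → ℝ) :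
    |P.E (P.es S u * P.es T v)| ≤ K ι ^ 2 * (δ * (P.nrm u * P.nrm v)) := by
  have hK := one_le_K (ι := ι)
  have key : ∀ {S T : Finset ι} (u v : Ω → ℝ) (i : ι), i ∈ S → i ∉ T →
      |P.E (P.es S u * P.es T v)| ≤ K ι ^ 2 * (δ * (P.nrm u * P.nrm v)) := by
    intro S T u v i hS hT
    have hu := P.nrm_nonneg u
    rw [← P.meas_es T v, E_mul_A]
    refine (P.abs_E_mul_le _ _).trans ?_
    calc _ ≤ (K ι * (δ * P.nrm u)) * (K ι * P.nrm v) := by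
          gcongr
          · exact P.nrm_nonneg _
          · exact nrm_A_es_le hP hδ hS hT u
          · exact P.nrm_es_le T v
      _ = _ := by ring
  obtain ⟨i, hi⟩ : ∃ i, ¬ (i ∈ S ↔ i ∈ T) := by
    by_contra! hc
    exact hne (ext hc)
  by_cases hS : i ∈ S
  · exact key u v i hS (by tauto)
  · rw [mul_comm (P.es S u), mul_comm (P.nrm u)]
    exact key v u i (by tauto) hS

lemma nrm_es_sq_le (S : Finset ι) (v : Ω → ℝ) :
    P.nrm (P.es S v) ^ 2 ≤ P.nrm v ^ 2 + 2 * K ι ^ 3 * (δ * P.nrm v ^ 2) := by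
  have hK := one_le_K (ι := ι)
  have h1 : P.E (P.es S v * v) =
      P.nrm (P.es S v) ^ 2 + ∑ T ∈ univ.erase S, P.E (P.es S v * P.es T v) := by
    rw [nrm_sq, add_sum_erase _ (fun T => P.E (P.es S v * P.es T v)) (mem_univ S), ← map_sum,
      ← mul_sum, P.sum_es v]
  have h2 : |∑ T ∈ univ.erase S, P.E (P.es S v * P.es T v)| ≤
      K ι * (K ι ^ 2 * (δ * (P.nrm v * P.nrm v))) := by
    refine (abs_sum_le_sum_abs _ _).trans ((sum_le_card_nsmul _ _ _ fun T hT =>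
      abs_E_es_mul_es_le hP hδ (ne_of_mem_erase hT).symm v v).trans ?_)
    rw [nsmul_eq_mul]
    have := P.nrm_nonneg v
    gcongr
    exact card_le_K _
  have h3 := P.E_mul_le (P.es S v) v
  have h4 := (abs_le.1 h2).1
  nlinarith [sq_nonneg (P.nrm (P.es S v) - P.nrm v)]

omit hδ in
lemma E_A_mul_A_le {S X Y : Finset ι} {p q : Ω → ℝ} (hp : P.Meas X p) (hq : P.Meas Y q) :
    P.E (P.A S p * P.A S q) ≤ P.E (P.A (S ∩ X ∩ Y) p * P.A (S ∩ X ∩ Y) q) +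
      2 * (δ * (P.nrm p * P.nrm q)) := by
  have h1 := P.E_mul_le p (P.A S (P.A Y q) - P.A (S ∩ Y) q)
  have h2 := P.E_mul_le p (P.A X (P.A (S ∩ Y) q) - P.A (X ∩ (S ∩ Y)) q)
  have h3 := mul_le_mul_of_nonneg_left (hP S Y q) (P.nrm_nonneg p)
  have h4 := mul_le_mul_of_nonneg_left (hP X (S ∩ Y) q) (P.nrm_nonneg p)
  rw [mul_sub, map_sub, hq] at h1
  rw [mul_sub, map_sub, E_mul_A, hp] at h2
  rw [hq] at h3
  have e : X ∩ (S ∩ Y) = S ∩ X ∩ Y := by rw [inter_left_comm, inter_assoc]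
  rw [e] at h2 h4
  rw [E_A_mul_A, E_A_mul_A]
  linarith

end AveragingSystem

namespace AveragingSystem

section

variable {ι : Type*} [Fintype ι] [DecidableEq ι]

lemma sum_pow_card_inter (S : Finset ι) (t : ℝ) :
    ∑ p : Finset ι × Finset ι with p.1 ∪ p.2 = S, t ^ (p.1 ∩ p.2).card = (2 + t) ^ S.card := by
  have h1 : (2 + t) ^ S.card = ∑ A ∈ S.powerset, ∑ C ∈ A.powerset, t ^ C.card := by
    rw [show 2 + t = (1 + t) + 1 by ring, ← sum_pow_mul_eq_add_pow]
    refine sum_congr rfl fun A _ => ?_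
    rw [add_comm, ← sum_pow_mul_eq_add_pow]
    simp
  rw [h1, sum_sigma']
  refine sum_nbij' (fun p => ⟨p.1, p.1 ∩ p.2⟩) (fun q => (q.1, (S \ q.1) ∪ q.2)) ?_ ?_ ?_ ?_ ?_
  · rintro ⟨A, B⟩ h
    simp only [mem_filter, mem_univ, true_and] at h
    simp only [mem_sigma, mem_powerset]
    exact ⟨h ▸ subset_union_left, inter_subset_left⟩
  · rintro ⟨A, C⟩ h
    simp only [mem_sigma, mem_powerset] at h
    simp only [mem_filter, mem_univ, true_and]
    ext i
    have := @h.1 i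
    have := @h.2 i
    simp only [mem_union, mem_sdiff]
    tauto
  · rintro ⟨A, B⟩ h
    simp only [mem_filter, mem_univ, true_and] at h
    subst h
    simp only [Prod.mk.injEq, true_and]
    ext i
    simp only [mem_union, mem_sdiff, mem_inter]
    tauto
  · rintro ⟨A, C⟩ h
    simp only [mem_sigma, mem_powerset] at h
    simp only [Sigma.mk.injEq, heq_eq_eq, true_and]
    ext i
    have := @h.1 i
    have := @h.2 i
    simp only [mem_union, mem_sdiff, mem_inter]
    tauto
  · intros; rfl

/-- The subsets of size at most `d`. -/
def low (ι : Type*) [Fintype ι] [DecidableEq ι] (d : ℕ) : Finset (Finset ι) :=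
  univ.filter fun T => T.card ≤ d

lemma mem_low {d : ℕ} {T : Finset ι} : T ∈ low ι d ↔ T.card ≤ d := by simp [low]

lemma sum_weights_le (S : Finset ι) (d : ℕ) :
    ∑ p ∈ low ι d ×ˢ low ι d with p.1 ∪ p.2 = S, (1 / 16 : ℝ) ^ (p.1 ∩ p.2).card ≤ 5 ^ d := by
  by_cases hS : S.card ≤ 2 * d
  · calc _ ≤ ∑ p : Finset ι × Finset ι with p.1 ∪ p.2 = S, (1 / 16 : ℝ) ^ (p.1 ∩ p.2).card :=
          sum_le_sum_of_subset_of_nonneg (filter_subset_filter _ (subset_univ _))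
            fun _ _ _ => by positivity
      _ = (2 + 1 / 16) ^ S.card := sum_pow_card_inter S _
      _ ≤ (2 + 1 / 16) ^ (2 * d) := pow_le_pow_right₀ (by norm_num) hS
      _ = ((2 + 1 / 16) ^ 2) ^ d := pow_mul _ _ _
      _ ≤ 5 ^ d := pow_le_pow_left₀ (by norm_num) (by norm_num) d
  · rw [sum_eq_zero_iff_of_nonneg (fun _ _ => by positivity) |>.2]
    · positivity
    · intro p hp
      simp only [mem_filter, mem_product, mem_low] at hp
      have := card_union_le p.1 p.2
      rw [hp.2] at this
      omega

/-- The pairs in `low ι d` with given traces on `S` and a common part outside `S`. -/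
def pairs (d : ℕ) (S : Finset ι) (q : Finset ι × Finset ι) : Finset (Finset ι × Finset ι) :=
  (low ι d ×ˢ low ι d).filter fun p => p.1 \ S = p.2 \ S ∧ (p.1 ∩ S, p.2 ∩ S) = q

omit [DecidableEq ι] in
lemma card_pairs_le (s : Finset (Finset ι × Finset ι)) : (s.card : ℝ) ≤ K ι ^ 2 := by
  have := card_le_univ s
  rw [Fintype.card_prod, Fintype.card_finset, ← sq] at this
  rw [K]
  exact_mod_cast this

lemma sq_le_sq_add {a b c e : ℝ} (ha : 0 ≤ a) (h : a ≤ b + e) (hb : b ≤ c) (he : 0 ≤ e) :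
    a ^ 2 ≤ b ^ 2 + (2 * (c * e) + e ^ 2) := by
  nlinarith

end

variable {ι Ω : Type*} [Fintype ι] [DecidableEq ι] [Fintype Ω] (P : AveragingSystem ι Ω)

/-- The sum of `f^{=T₁} f^{=T₂}` over `pairs d S q`. -/
noncomputable def pairSum (d : ℕ) (f : Ω → ℝ) (S : Finset ι) (q : Finset ι × Finset ι) : Ω → ℝ :=
  ∑ p ∈ pairs d S q, P.es p.1 f * P.es p.2 f

/-- The energy above `A`, seen from `R`. -/
noncomputable def energy (d : ℕ) (f : Ω → ℝ) (R A : Finset ι) : Ω → ℝ :=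
  ∑ T ∈ low ι d with A ⊆ T, P.A R (P.es T f * P.es T f)

/-- The truncated Laplacian. -/
noncomputable def lap (d : ℕ) (f : Ω → ℝ) (R : Finset ι) : Ω → ℝ :=
  ∑ T ∈ low ι d with R ⊆ T, P.es T f

lemma A_mul_self_nonneg (R : Finset ι) (u : Ω → ℝ) : 0 ≤ P.A R (u * u) :=
  P.nonneg R _ fun _ => mul_self_nonneg _

lemma energy_nonneg (d : ℕ) (f : Ω → ℝ) (R A : Finset ι) : 0 ≤ P.energy d f R A :=
  sum_nonneg fun _ _ => P.A_mul_self_nonneg R _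

lemma nrm_sum_es_mul_es_le (s : Finset (Finset ι × Finset ι)) {f : Ω → ℝ} {M : ℝ} (hM : 0 ≤ M)
    (h : ∀ x, |f x| ≤ M) :
    P.nrm (∑ p ∈ s, P.es p.1 f * P.es p.2 f) ≤ K ι ^ 4 * (P.nrm f * M) := by
  have hK := one_le_K (ι := ι)
  have hf := P.nrm_nonneg f
  exact (P.nrm_sum_le_of_le s _ (by positivity) (card_pairs_le s)
    fun p _ => P.nrm_es_mul_es_le p.1 p.2 hM h).trans (le_of_eq (by ring))

lemma sum_energy_le (d : ℕ) (f : Ω → ℝ) {R : Finset ι} :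
    ∑ A ∈ low ι d with R ⊆ A, P.energy d f R A ≤ (2 : ℝ) ^ (d - R.card) • P.energy d f R R := by
  have h : ∑ A ∈ low ι d with R ⊆ A, P.energy d f R A =
      ∑ T ∈ low ι d with R ⊆ T, ∑ _A ∈ Icc R T, P.A R (P.es T f * P.es T f) := by
    refine sum_comm' fun A T => ?_
    simp only [mem_filter, mem_low, mem_Icc]
    constructor
    · rintro ⟨⟨h1, h2⟩, h3, h4⟩
      exact ⟨⟨h2, h4⟩, h3, h2.trans h4⟩
    · rintro ⟨⟨h2, h4⟩, h3, h5⟩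
      exact ⟨⟨(card_le_card h4).trans h3, h2⟩, h3, h4⟩
  rw [h, energy, smul_sum]
  refine sum_le_sum fun T hT => ?_
  simp only [mem_filter, mem_low] at hT
  rw [sum_const, card_Icc_finset hT.2, ← Nat.cast_smul_eq_nsmul ℝ]
  refine smul_le_smul_of_nonneg_right ?_ (P.A_mul_self_nonneg R _)
  push_cast
  exact pow_le_pow_right₀ (by norm_num) (by omega)

lemma sum_E_energy_mul_energy_le (d : ℕ) (f : Ω → ℝ) (R : Finset ι) :
    ∑ p ∈ low ι d ×ˢ low ι d with p.1 ∩ p.2 = R,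
        P.E (P.energy d f R p.1 * P.energy d f R p.2) ≤
      4 ^ (d - R.card) * P.nrm (P.energy d f R R) ^ 2 := by
  set U := ∑ A ∈ low ι d with R ⊆ A, P.energy d f R A with hU
  have hU0 : 0 ≤ U := sum_nonneg fun A _ => P.energy_nonneg d f R A
  calc _ ≤ ∑ p ∈ ((low ι d).filter (R ⊆ ·)) ×ˢ ((low ι d).filter (R ⊆ ·)),
          P.E (P.energy d f R p.1 * P.energy d f R p.2) := by
        refine sum_le_sum_of_subset_of_nonneg ?_ fun p _ _ => P.E_nonneg
          (mul_nonneg (P.energy_nonneg d f R _) (P.energy_nonneg d f R _))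
        intro p hp
        simp only [mem_filter, mem_product] at hp ⊢
        rw [← hp.2]
        exact ⟨⟨hp.1.1, inter_subset_left⟩, hp.1.2, inter_subset_right⟩
    _ = P.nrm U ^ 2 := by
        rw [nrm_sq, hU, sum_mul_sum, sum_product, map_sum]
        simp_rw [map_sum]
    _ ≤ (2 ^ (d - R.card) * P.nrm (P.energy d f R R)) ^ 2 := by
        refine pow_le_pow_left₀ (P.nrm_nonneg _) ?_ 2
        rw [← abs_of_nonneg (show (0 : ℝ) ≤ 2 ^ (d - R.card) by positivity), ← nrm_smul]
        refine P.nrm_le_of_abs_le fun x => ?_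
        have := P.sum_energy_le d f (R := R) x
        rw [abs_of_nonneg (hU0 x)]
        exact this.trans (le_abs_self _)
    _ = _ := by rw [mul_pow, ← pow_mul, mul_comm _ 2, pow_mul]; norm_num

lemma E_A_pairSum_sq_le (d : ℕ) (f : Ω → ℝ) (S A B : Finset ι) :
    P.nrm (P.A S (P.pairSum d f S (A, B))) ^ 2 ≤
      P.E ((∑ T ∈ low ι d with T ∩ S = A, P.A S (P.es T f * P.es T f)) *
        ∑ T ∈ low ι d with T ∩ S = B, P.A S (P.es T f * P.es T f)) := by
  rw [nrm_sq]
  have key : ∀ (π : Finset ι × Finset ι → Finset ι) (D : Finset ι),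
      (∀ p ∈ pairs d S (A, B), π p ∈ low ι d ∧ π p ∩ S = D) →
      Set.InjOn π (pairs d S (A, B)) →
      ∑ p ∈ pairs d S (A, B), P.A S (P.es (π p) f * P.es (π p) f) ≤
        ∑ T ∈ low ι d with T ∩ S = D, P.A S (P.es T f * P.es T f) := by
    intro π D h1 h2
    rw [← sum_image (f := fun T => P.A S (P.es T f * P.es T f)) h2]
    refine sum_le_sum_of_subset_of_nonneg ?_ fun _ _ _ => P.A_mul_self_nonneg S _
    intro T hT
    obtain ⟨p, hp, rfl⟩ := mem_image.1 hT
    simpa using h1 p hp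
  have eq_of : ∀ T T' : Finset ι, T \ S = T' \ S → T ∩ S = T' ∩ S → T = T' := by
    intro T T' h1 h2
    rw [← sdiff_union_inter T S, h1, h2, sdiff_union_inter]
  refine P.E_mono fun x => ?_
  have h := P.A_sum_mul_sq_le S (pairs d S (A, B)) (fun p => P.es p.1 f) (fun p => P.es p.2 f) x
  rw [sq] at h
  refine h.trans (mul_le_mul (key Prod.fst A ?_ ?_ x) (key Prod.snd B ?_ ?_ x) ?_ ?_)
  · intro p hp
    simp only [pairs, mem_filter, mem_product, Prod.mk.injEq] at hp
    exact ⟨hp.1.1, hp.2.2.1⟩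
  · intro p hp p' hp' e
    simp only [pairs, coe_filter, mem_product, Prod.mk.injEq, Set.mem_ofPred_eq] at hp hp'
    refine Prod.ext e (eq_of _ _ ?_ ?_)
    · rw [← hp.2.1, ← hp'.2.1, e]
    · rw [hp.2.2.2, hp'.2.2.2]
  · intro p hp
    simp only [pairs, mem_filter, mem_product, Prod.mk.injEq] at hp
    exact ⟨hp.1.2, hp.2.2.2⟩
  · intro p hp p' hp' e
    simp only [pairs, coe_filter, mem_product, Prod.mk.injEq, Set.mem_ofPred_eq] at hp hp'
    refine Prod.ext (eq_of _ _ ?_ ?_) e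
    · rw [hp.2.1, hp'.2.1, e]
    · rw [hp.2.2.1, hp'.2.2.1]
  · exact sum_nonneg (fun p _ => P.A_mul_self_nonneg S _) x
  · exact sum_nonneg (fun T _ => P.A_mul_self_nonneg S _) x

variable {P} {δ : ℝ} (hP : P.Almost δ) (hδ : 0 ≤ δ)

include hP hδ

lemma nrm_energy_sq_le (hδ1 : δ ≤ 1) (d : ℕ) (R : Finset ι) {f : Ω → ℝ} {M : ℝ} (hM : 0 ≤ M)
    (h : ∀ x, |f x| ≤ M) :
    P.nrm (P.energy d f R R) ^ 2 ≤ P.nrm (P.A R (P.lap d f R * P.lap d f R)) ^ 2 +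
      3 * K ι ^ 8 * (δ * (P.nrm f * M) ^ 2) := by
  have hK := one_le_K (ι := ι)
  have hf := P.nrm_nonneg f
  set s := (low ι d).filter (R ⊆ ·) with hs
  have e1 : P.lap d f R * P.lap d f R = ∑ p ∈ s ×ˢ s, P.es p.1 f * P.es p.2 f := by
    rw [lap, sum_mul_sum, sum_product]
  have e2 : P.A R (P.lap d f R * P.lap d f R) =
      P.energy d f R R + ∑ p ∈ s.offDiag, P.A R (P.es p.1 f * P.es p.2 f) := by
    rw [e1, map_sum, ← diag_union_offDiag, sum_union (disjoint_diag_offDiag s), sum_diag, energy]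
  have h1 : P.nrm (∑ p ∈ s.offDiag, P.A R (P.es p.1 f * P.es p.2 f)) ≤
      K ι ^ 2 * (K ι ^ 2 * (δ * (P.nrm f * M))) := by
    refine P.nrm_sum_le_of_le _ _ (by positivity) (card_pairs_le _) fun p hp => ?_
    simp only [mem_offDiag, hs, mem_filter] at hp
    refine nrm_A_es_mul_es_le hP hδ (fun e => hp.2.2 ?_) hM h
    rw [← sdiff_union_of_subset hp.1.2, e, sdiff_union_of_subset hp.2.1.2]
  have h2 : P.nrm (P.A R (P.lap d f R * P.lap d f R)) ≤ K ι ^ 4 * (P.nrm f * M) := by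
    rw [e1]
    exact (P.nrm_A_le R _).trans (P.nrm_sum_es_mul_es_le _ hM h)
  have h3 : P.nrm (P.energy d f R R) ≤ P.nrm (P.A R (P.lap d f R * P.lap d f R)) +
      K ι ^ 2 * (K ι ^ 2 * (δ * (P.nrm f * M))) := by
    have h4 := P.nrm_add_le (P.A R (P.lap d f R * P.lap d f R))
      ((-1 : ℝ) • ∑ p ∈ s.offDiag, P.A R (P.es p.1 f * P.es p.2 f))
    rw [nrm_smul, abs_neg, abs_one, one_mul] at h4
    rw [show P.energy d f R R = P.A R (P.lap d f R * P.lap d f R) +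
      (-1 : ℝ) • ∑ p ∈ s.offDiag, P.A R (P.es p.1 f * P.es p.2 f) by rw [e2]; simp]
    exact h4.trans (by gcongr)
  refine (sq_le_sq_add (P.nrm_nonneg _) h3 h2 (by positivity)).trans ?_
  have hδ2 : δ ^ 2 ≤ δ := by nlinarith
  have : 0 ≤ K ι ^ 8 * (P.nrm f * M) ^ 2 := by positivity
  nlinarith

lemma nrm_es_pairSum_sq_le (d : ℕ) (A B : Finset ι) {f : Ω → ℝ} {M : ℝ} (hM : 0 ≤ M)
    (h : ∀ x, |f x| ≤ M) :
    P.nrm (P.es (A ∪ B) (P.pairSum d f (A ∪ B) (A, B))) ^ 2 ≤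
      P.E (P.energy d f (A ∩ B) A * P.energy d f (A ∩ B) B) +
        4 * K ι ^ 11 * (δ * (P.nrm f * M) ^ 2) := by
  have hK := one_le_K (ι := ι)
  have hf := P.nrm_nonneg f
  set S := A ∪ B with hS
  set R := A ∩ B with hR
  have h1 := nrm_es_sq_le hP hδ S (P.A S (P.pairSum d f S (A, B)))
  rw [es_A] at h1
  have h2 : P.nrm (P.A S (P.pairSum d f S (A, B))) ^ 2 ≤ (K ι ^ 4 * (P.nrm f * M)) ^ 2 :=
    pow_le_pow_left₀ (P.nrm_nonneg _)
      ((P.nrm_A_le _ _).trans (P.nrm_sum_es_mul_es_le _ hM h)) 2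
  have h3 := P.E_A_pairSum_sq_le d f S A B
  have h4 : P.E ((∑ T ∈ low ι d with T ∩ S = A, P.A S (P.es T f * P.es T f)) *
        ∑ T ∈ low ι d with T ∩ S = B, P.A S (P.es T f * P.es T f)) ≤
      P.E ((∑ T ∈ low ι d with T ∩ S = A, P.A R (P.es T f * P.es T f)) *
        ∑ T ∈ low ι d with T ∩ S = B, P.A R (P.es T f * P.es T f)) +
        K ι ^ 2 * (2 * (δ * (K ι ^ 2 * (P.nrm f * M)) ^ 2)) := by
    simp only [sum_mul_sum, map_sum]
    rw [← sum_product', ← sum_product']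
    set s := ((low ι d).filter (· ∩ S = A)) ×ˢ ((low ι d).filter (· ∩ S = B)) with hs
    have h5 : ∀ p ∈ s, P.E (P.A S (P.es p.1 f * P.es p.1 f) * P.A S (P.es p.2 f * P.es p.2 f)) ≤
        P.E (P.A R (P.es p.1 f * P.es p.1 f) * P.A R (P.es p.2 f * P.es p.2 f)) +
          2 * (δ * (K ι ^ 2 * (P.nrm f * M)) ^ 2) := by
      intro p hp
      simp only [hs, mem_product, mem_filter] at hp
      have h6 := E_A_mul_A_le hP (S := S) ((P.meas_es p.1 f).mul (P.meas_es p.1 f))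
        ((P.meas_es p.2 f).mul (P.meas_es p.2 f))
      have e : S ∩ p.1 ∩ p.2 = R := by
        rw [hR, ← hp.1.2, ← hp.2.2]
        ext i
        simp only [mem_inter]
        tauto
      rw [e] at h6
      refine h6.trans ?_
      have h7 := P.nrm_es_mul_es_le p.1 p.1 hM h
      have h8 := P.nrm_es_mul_es_le p.2 p.2 hM h
      rw [sq]
      gcongr
      exact P.nrm_nonneg _
    refine (sum_le_sum h5).trans ?_
    rw [sum_add_distrib, sum_const, nsmul_eq_mul]
    gcongr
    exact card_pairs_le s
  have h9 : P.E ((∑ T ∈ low ι d with T ∩ S = A, P.A R (P.es T f * P.es T f)) *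
        ∑ T ∈ low ι d with T ∩ S = B, P.A R (P.es T f * P.es T f)) ≤
      P.E (P.energy d f R A * P.energy d f R B) := by
    have key : ∀ D : Finset ι, ∑ T ∈ low ι d with T ∩ S = D, P.A R (P.es T f * P.es T f) ≤
        P.energy d f R D := fun D =>
      sum_le_sum_of_subset_of_nonneg
        (monotone_filter_right _ fun T _ hT => by
          rw [← hT]
          exact inter_subset_left)
        fun _ _ _ => P.A_mul_self_nonneg R _
    refine P.E_mono fun x => mul_le_mul (key A x) (key B x) ?_ (P.energy_nonneg d f R A x)
    exact sum_nonneg (fun T _ => P.A_mul_self_nonneg R _) x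
  have h10 : 2 * K ι ^ 3 * (δ * P.nrm (P.A S (P.pairSum d f S (A, B))) ^ 2) ≤
      2 * K ι ^ 3 * (δ * (K ι ^ 4 * (P.nrm f * M)) ^ 2) := by gcongr
  have h11 : K ι ^ 6 * (δ * (P.nrm f * M) ^ 2) ≤ K ι ^ 11 * (δ * (P.nrm f * M) ^ 2) := by
    gcongr
    norm_num
  nlinarith


lemma nrm_sum_es_sq_le (H : Finset ι → Ω → ℝ) {c : ℝ} (hH : ∀ S, P.nrm (H S) ≤ c) :
    P.nrm (∑ S, P.es S (H S)) ^ 2 ≤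
      ∑ S, P.nrm (P.es S (H S)) ^ 2 + K ι ^ 2 * (K ι ^ 2 * (δ * (c * c))) := by
  have hK := one_le_K (ι := ι)
  have hc : 0 ≤ c := (P.nrm_nonneg _).trans (hH ∅)
  rw [nrm_sq, sum_mul_sum, ← sum_product', ← diag_union_offDiag,
    sum_union (disjoint_diag_offDiag _), sum_diag, map_add, map_sum, map_sum]
  simp_rw [nrm_sq]
  gcongr
  refine (sum_le_card_nsmul _ _ (K ι ^ 2 * (δ * (c * c))) fun p hp => ?_).trans ?_
  · refine (le_abs_self _).trans
      ((abs_E_es_mul_es_le hP hδ (mem_offDiag.1 hp).2.2 _ _).trans ?_)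
    gcongr
    · exact P.nrm_nonneg _
    · exact hH _
    · exact hH _
  · rw [nsmul_eq_mul]
    gcongr
    exact card_pairs_le _

/-- The pairs whose product can have a component at `S` in an exact product space. -/
def goodPairs (ι : Type*) [Fintype ι] [DecidableEq ι] (d : ℕ) (S : Finset ι) :
    Finset (Finset ι × Finset ι) :=
  (low ι d ×ˢ low ι d).filter fun p => p.1 \ S = p.2 \ S ∧ S ⊆ p.1 ∪ p.2

lemma nrm_sq_mul_self_le (hδ1 : δ ≤ 1) (d : ℕ) {f : Ω → ℝ} {M : ℝ} (hM : 0 ≤ M)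
    (h : ∀ x, |f x| ≤ M) :
    P.nrm ((∑ T ∈ low ι d, P.es T f) * ∑ T ∈ low ι d, P.es T f) ^ 2 ≤
      ∑ S, P.nrm (P.es S (∑ p ∈ goodPairs ι d S, P.es p.1 f * P.es p.2 f)) ^ 2 +
        4 * K ι ^ 12 * (δ * (P.nrm f * M) ^ 2) := by
  have hK := one_le_K (ι := ι)
  have hf := P.nrm_nonneg f
  set H : Finset ι → Ω → ℝ := fun S => ∑ p ∈ goodPairs ι d S, P.es p.1 f * P.es p.2 f with hH
  set bad : Finset ι → Ω → ℝ := fun S =>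
    ∑ p ∈ (low ι d ×ˢ low ι d).filter fun p => ¬ (p.1 \ S = p.2 \ S ∧ S ⊆ p.1 ∪ p.2),
      P.es S (P.es p.1 f * P.es p.2 f) with hbad
  have hHn : ∀ S, P.nrm (H S) ≤ K ι ^ 4 * (P.nrm f * M) := fun S =>
    P.nrm_sum_es_mul_es_le _ hM h
  have e : (∑ T ∈ low ι d, P.es T f) * ∑ T ∈ low ι d, P.es T f =
      ∑ S, P.es S (H S) + ∑ S, bad S := by
    rw [← P.sum_es ((∑ T ∈ low ι d, P.es T f) * ∑ T ∈ low ι d, P.es T f), ← sum_add_distrib]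
    refine sum_congr rfl fun S _ => ?_
    rw [sum_mul_sum, ← sum_product', map_sum, hH, hbad, map_sum, goodPairs,
      sum_filter_add_sum_filter_not]
  have h1 : P.nrm (∑ S, bad S) ≤ K ι * (K ι ^ 2 * (K ι ^ 3 * (δ * (P.nrm f * M)))) := by
    refine P.nrm_sum_le_of_le _ _ (by positivity) (card_le_K _) fun S _ => ?_
    refine P.nrm_sum_le_of_le _ _ (by positivity) (card_pairs_le _) fun p hp => ?_
    exact nrm_es_es_mul_es_le hP hδ (mem_filter.1 hp).2 hM h
  have h2 : P.nrm (∑ S, P.es S (H S)) ≤ K ι * (K ι * (K ι ^ 4 * (P.nrm f * M))) := by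
    refine P.nrm_sum_le_of_le _ _ (by positivity) (card_le_K _) fun S _ => ?_
    exact (P.nrm_es_le S _).trans (mul_le_mul_of_nonneg_left (hHn S) (by positivity))
  have h3 := nrm_sum_es_sq_le hP hδ H hHn
  rw [e]
  refine (sq_le_sq_add (P.nrm_nonneg _) ((P.nrm_add_le _ _).trans (add_le_add_right h1 _)) h2
    (by positivity)).trans ?_
  have hδ2 : δ ^ 2 ≤ δ := by nlinarith
  have : 0 ≤ K ι ^ 12 * (P.nrm f * M) ^ 2 := by positivity
  nlinarith

omit hP hδ in
lemma nrm_es_goodPairs_sq_le (d : ℕ) (f : Ω → ℝ) (S : Finset ι) :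
    P.nrm (P.es S (∑ p ∈ goodPairs ι d S, P.es p.1 f * P.es p.2 f)) ^ 2 ≤
      5 ^ d * ∑ q ∈ low ι d ×ˢ low ι d with q.1 ∪ q.2 = S,
        16 ^ (q.1 ∩ q.2).card * P.nrm (P.es S (P.pairSum d f S q)) ^ 2 := by
  have e : ∑ p ∈ goodPairs ι d S, P.es p.1 f * P.es p.2 f =
      ∑ q ∈ low ι d ×ˢ low ι d with q.1 ∪ q.2 = S, P.pairSum d f S q := by
    rw [← sum_fiberwise_of_maps_to (t := (low ι d ×ˢ low ι d).filter fun q => q.1 ∪ q.2 = S)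
      (g := fun p => (p.1 ∩ S, p.2 ∩ S))]
    · refine sum_congr rfl fun q hq => ?_
      rw [pairSum]
      refine sum_congr ?_ fun _ _ => rfl
      simp only [mem_filter] at hq
      rw [pairs, goodPairs, filter_filter]
      refine filter_congr fun p _ => ⟨fun hp => ⟨hp.1.1, hp.2⟩, fun hp => ⟨⟨hp.1, ?_⟩, hp.2⟩⟩
      have h2 := hq.2
      rw [← hp.2, ← union_inter_distrib_right] at h2
      exact inter_eq_right.1 h2
    · intro p hp
      simp only [goodPairs, mem_filter, mem_product, mem_low] at hp ⊢
      refine ⟨⟨(card_le_card inter_subset_left).trans hp.1.1,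
        (card_le_card inter_subset_left).trans hp.1.2⟩, ?_⟩
      rw [← union_inter_distrib_right]
      exact inter_eq_right.2 hp.2.2
  rw [e, map_sum]
  calc _ ≤ (∑ q ∈ low ι d ×ˢ low ι d with q.1 ∪ q.2 = S,
          P.nrm (P.es S (P.pairSum d f S q))) ^ 2 :=
        pow_le_pow_left₀ (P.nrm_nonneg _) (P.nrm_sum_le _ _) 2
    _ ≤ (∑ q ∈ low ι d ×ˢ low ι d with q.1 ∪ q.2 = S, (1 / 16 : ℝ) ^ (q.1 ∩ q.2).card) *
        ∑ q ∈ low ι d ×ˢ low ι d with q.1 ∪ q.2 = S,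
          16 ^ (q.1 ∩ q.2).card * P.nrm (P.es S (P.pairSum d f S q)) ^ 2 := by
        refine sum_sq_le_sum_mul_sum_of_sq_le_mul _ (fun _ _ => by positivity)
          (fun _ _ => by positivity) fun q _ => ?_
        rw [← mul_assoc, ← mul_pow]
        norm_num
    _ ≤ _ := mul_le_mul_of_nonneg_right (sum_weights_le S d)
        (sum_nonneg fun _ _ => by positivity)

lemma sum_nrm_es_goodPairs_sq_le (hδ1 : δ ≤ 1) (d : ℕ) (hd : d ≤ Fintype.card ι) {f : Ω → ℝ}
    {M : ℝ} (hM : 0 ≤ M) (h : ∀ x, |f x| ≤ M) :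
    ∑ S, P.nrm (P.es S (∑ p ∈ goodPairs ι d S, P.es p.1 f * P.es p.2 f)) ^ 2 ≤
      20 ^ d * ∑ R ∈ low ι d, 4 ^ R.card * P.nrm (P.A R (P.lap d f R * P.lap d f R)) ^ 2 +
        7 * K ι ^ 13 * 80 ^ Fintype.card ι * (δ * (P.nrm f * M) ^ 2) := by
  have hK := one_le_K (ι := ι)
  have hf := P.nrm_nonneg f
  set n := Fintype.card ι with hn
  set err := δ * (P.nrm f * M) ^ 2 with herr
  have herr0 : 0 ≤ err := by positivity
  calc _ ≤ ∑ S, 5 ^ d * ∑ q ∈ low ι d ×ˢ low ι d with q.1 ∪ q.2 = S, 16 ^ (q.1 ∩ q.2).card *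
          (P.E (P.energy d f (q.1 ∩ q.2) q.1 * P.energy d f (q.1 ∩ q.2) q.2) +
            4 * K ι ^ 11 * err) := by
        refine sum_le_sum fun S _ => (nrm_es_goodPairs_sq_le d f S).trans ?_
        gcongr with q hq
        obtain ⟨A, B⟩ := q
        obtain rfl := (mem_filter.1 hq).2
        exact nrm_es_pairSum_sq_le hP hδ d A B hM h
    _ = 5 ^ d * ∑ q ∈ low ι d ×ˢ low ι d, 16 ^ (q.1 ∩ q.2).card *
          P.E (P.energy d f (q.1 ∩ q.2) q.1 * P.energy d f (q.1 ∩ q.2) q.2) +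
        5 ^ d * ∑ q ∈ low ι d ×ˢ low ι d, 16 ^ (q.1 ∩ q.2).card * (4 * K ι ^ 11 * err) := by
        rw [← mul_sum, sum_fiberwise, ← mul_add, ← sum_add_distrib]
        simp_rw [mul_add]
    _ ≤ 5 ^ d * ∑ R ∈ low ι d, 16 ^ R.card * (4 ^ (d - R.card) *
          (P.nrm (P.A R (P.lap d f R * P.lap d f R)) ^ 2 + 3 * K ι ^ 8 * err)) +
        5 ^ d * (K ι ^ 2 * (16 ^ n * (4 * K ι ^ 11 * err))) := by
        gcongr
        · rw [← sum_fiberwise_of_maps_to (t := low ι d) (g := fun q => q.1 ∩ q.2)]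
          · refine sum_le_sum fun R _ => ?_
            calc _ = 16 ^ R.card * ∑ q ∈ low ι d ×ˢ low ι d with q.1 ∩ q.2 = R,
                  P.E (P.energy d f R q.1 * P.energy d f R q.2) := by
                  rw [mul_sum]
                  exact sum_congr rfl fun q hq => by rw [(mem_filter.1 hq).2]
              _ ≤ _ := by
                  gcongr
                  refine (P.sum_E_energy_mul_energy_le d f R).trans ?_
                  gcongr
                  exact nrm_energy_sq_le hP hδ hδ1 d R hM h
          · intro q hq
            simp only [mem_product, mem_low] at hq ⊢
            exact (card_le_card inter_subset_left).trans hq.1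
        · refine (sum_le_card_nsmul _ _ (16 ^ n * (4 * K ι ^ 11 * err)) fun q _ => ?_).trans ?_
          · gcongr
            · norm_num
            · exact card_le_univ _
          · rw [nsmul_eq_mul]
            gcongr
            exact card_pairs_le _
    _ = 20 ^ d * ∑ R ∈ low ι d, 4 ^ R.card *
          (P.nrm (P.A R (P.lap d f R * P.lap d f R)) ^ 2 + 3 * K ι ^ 8 * err) +
        5 ^ d * (K ι ^ 2 * (16 ^ n * (4 * K ι ^ 11 * err))) := by
        congr 1
        rw [mul_sum, mul_sum]
        refine sum_congr rfl fun R hR => ?_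
        have e : (20 : ℝ) ^ d * 4 ^ R.card = 5 ^ d * (16 ^ R.card * 4 ^ (d - R.card)) := by
          obtain ⟨m, hm⟩ := Nat.exists_eq_add_of_le (mem_low.1 hR)
          rw [hm, Nat.add_sub_cancel_left, show (20 : ℝ) = 5 * 4 by norm_num,
            show (16 : ℝ) = 4 * 4 by norm_num, mul_pow, mul_pow, pow_add (4 : ℝ)]
          ring
        linear_combination
          -(P.nrm (P.A R (P.lap d f R * P.lap d f R)) ^ 2 + 3 * K ι ^ 8 * err) * e
    _ ≤ 20 ^ d * ∑ R ∈ low ι d, 4 ^ R.card * P.nrm (P.A R (P.lap d f R * P.lap d f R)) ^ 2 +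
        20 ^ n * (K ι * (4 ^ n * (3 * K ι ^ 8 * err))) +
        5 ^ n * (K ι ^ 2 * (16 ^ n * (4 * K ι ^ 11 * err))) := by
        simp_rw [mul_add, sum_add_distrib, mul_add]
        refine add_le_add (add_le_add le_rfl ?_) ?_
        · gcongr
          · norm_num
          · refine (sum_le_card_nsmul _ _ (4 ^ n * (3 * K ι ^ 8 * err)) fun R _ => ?_).trans ?_
            · gcongr
              · norm_num
              · exact card_le_univ R
            · rw [nsmul_eq_mul]
              gcongr
              exact card_le_K _
        · gcongr
          norm_num
    _ ≤ _ := by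
        have e1 : (20 : ℝ) ^ n * 4 ^ n = 80 ^ n := by rw [← mul_pow]; norm_num
        have e2 : (5 : ℝ) ^ n * 16 ^ n = 80 ^ n := by rw [← mul_pow]; norm_num
        have e3 : K ι ^ 9 ≤ K ι ^ 13 := pow_le_pow_right₀ hK (by norm_num)
        have e4 : K ι ^ 9 * (80 ^ n * err) ≤ K ι ^ 13 * (80 ^ n * err) := by gcongr
        calc _ = 20 ^ d * ∑ R ∈ low ι d,
                4 ^ R.card * P.nrm (P.A R (P.lap d f R * P.lap d f R)) ^ 2 +
              3 * (K ι ^ 9 * ((20 ^ n * 4 ^ n) * err)) +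
              4 * (K ι ^ 13 * ((5 ^ n * 16 ^ n) * err)) := by ring
          _ ≤ _ := by
              rw [e1, e2]
              linarith

theorem nrm_low_sq_le (hδ1 : δ ≤ 1) (d : ℕ) (hd : d ≤ Fintype.card ι) {f : Ω → ℝ}
    {M : ℝ} (hM : 0 ≤ M) (h : ∀ x, |f x| ≤ M) :
    P.nrm ((∑ T ∈ low ι d, P.es T f) * ∑ T ∈ low ι d, P.es T f) ^ 2 ≤
      20 ^ d * ∑ R ∈ low ι d, 4 ^ R.card * P.nrm (P.A R (P.lap d f R * P.lap d f R)) ^ 2 +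
        (7 * K ι ^ 13 * 80 ^ Fintype.card ι + 4 * K ι ^ 12) * (δ * (P.nrm f * M) ^ 2) := by
  have h1 := nrm_sq_mul_self_le hP hδ hδ1 d hM h
  have h2 := sum_nrm_es_goodPairs_sq_le hP hδ hδ1 d hd hM h
  linarith


omit hP hδ

variable (P) in
/-- The bilinear form of `A S ∘ A T - A (S ∩ T)` is bounded by `e`. -/
def BilinClose (e : ℝ) (S T : Finset ι) : Prop :=
  ∀ u v, |P.E (P.A S u * P.A T v) - P.E (P.A (S ∩ T) u * P.A (S ∩ T) v)| ≤
    e * (P.nrm u * P.nrm v)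

lemma BilinClose.symm {e : ℝ} {S T : Finset ι} (h : P.BilinClose e S T) : P.BilinClose e T S := by
  intro u v
  have := h v u
  rwa [inter_comm T, mul_comm (P.A T u), mul_comm (P.A (S ∩ T) u), mul_comm (P.nrm u)]

lemma BilinClose.mono {e e' : ℝ} {S T : Finset ι} (h : P.BilinClose e S T) (he : e ≤ e') :
    P.BilinClose e' S T := fun u v =>
  (h u v).trans (mul_le_mul_of_nonneg_right he (mul_nonneg (P.nrm_nonneg u) (P.nrm_nonneg v)))

lemma BilinClose.of_subset {S T : Finset ι} (h : S ⊆ T) : P.BilinClose 0 S T := by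
  intro u v
  rw [inter_eq_left.2 h, E_mul_A, P.comp_of_superset S T h, E_A_mul_A, E_mul_A]
  simp

lemma BilinClose.step {e : ℝ} (he : 0 ≤ e) {S T : Finset ι} {j : ι} (hS : j ∉ S)
    (h1 : P.BilinClose e (S ∪ T.erase j) T) (h2 : P.BilinClose e S (T.erase j)) :
    P.BilinClose (2 * e) S T := by
  intro u v
  have e1 : (S ∪ T.erase j) ∩ T = T.erase j := by
    ext i
    by_cases hi : i = j <;> simp [hi, hS]
    tauto
  have e2 : S ∩ T.erase j = S ∩ T := by
    ext i
    by_cases hi : i = j <;> simp [hi, hS]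
  have h3 := h1 (P.A S u) v
  have h4 := h2 u v
  rw [P.comp_of_superset S _ subset_union_left, e1, E_A_mul_A] at h3
  rw [e2] at h4
  have h5 : e * (P.nrm (P.A S u) * P.nrm v) ≤ e * (P.nrm u * P.nrm v) := by
    have := P.nrm_nonneg v
    gcongr
    exact P.nrm_A_le S u
  rw [abs_le] at *
  constructor <;> linarith

lemma bilinClose_of_pairs {e : ℝ} (he : 0 ≤ e)
    (h : ∀ R i j, i ∉ R → j ∉ R → i ≠ j → P.BilinClose e (insert i R) (insert j R)) (n : ℕ) :
    ∀ S T : Finset ι, (S \ T).card + (T \ S).card ≤ n → P.BilinClose (2 ^ n * e) S T := by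
  induction n with
  | zero =>
    intro S T hn
    have : S \ T = ∅ := card_eq_zero.1 (by omega)
    exact (BilinClose.of_subset (sdiff_eq_empty_iff_subset.1 this)).mono (by positivity)
  | succ n ih =>
    have step : ∀ S T : Finset ι, (S \ T).card + (T \ S).card ≤ n + 1 → 2 ≤ (T \ S).card →
        P.BilinClose (2 ^ (n + 1) * e) S T := by
      intro S T hn h2
      obtain ⟨j, hj⟩ := card_pos.1 (show 0 < (T \ S).card by omega)
      obtain ⟨hT, hS⟩ := mem_sdiff.1 hj
      have e1 : (S ∪ T.erase j) \ T = S \ T := by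
        ext i
        simp only [mem_sdiff, mem_union, mem_erase]
        tauto
      have e2 : T \ (S ∪ T.erase j) = {j} := by
        ext i
        by_cases hi : i = j
        · simp [hi, hT, hS]
        · simp only [mem_sdiff, mem_union, mem_erase, mem_singleton]
          tauto
      have e3 : T.erase j \ S = (T \ S).erase j := by
        ext i
        simp only [mem_sdiff, mem_erase]
        tauto
      have e4 : S \ T.erase j = S \ T := by
        ext i
        by_cases hi : i = j
        · simp [hi, hS]
        · simp [hi]
      have := BilinClose.step (P := P) (e := 2 ^ n * e) (by positivity) hS
        (ih _ _ (by rw [e1, e2, card_singleton]; omega))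
        (ih _ _ (by rw [e3, e4, card_erase_of_mem hj]; omega))
      exact this.mono (le_of_eq (by ring))
    intro S T hn
    by_cases h0 : (S \ T).card = 0
    · exact (BilinClose.of_subset (sdiff_eq_empty_iff_subset.1 (card_eq_zero.1 h0))).mono
        (by positivity)
    by_cases h1 : (T \ S).card = 0
    · exact (BilinClose.of_subset
        (sdiff_eq_empty_iff_subset.1 (card_eq_zero.1 h1))).symm.mono (by positivity)
    by_cases h2 : 2 ≤ (T \ S).card
    · exact step S T hn h2
    by_cases h3 : 2 ≤ (S \ T).card
    · exact (step T S (by omega) h3).symm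
    obtain ⟨i, hi⟩ := card_eq_one.1 (show (S \ T).card = 1 by omega)
    obtain ⟨j, hj⟩ := card_eq_one.1 (show (T \ S).card = 1 by omega)
    have hi' : i ∈ S \ T := hi ▸ mem_singleton_self i
    have hj' : j ∈ T \ S := hj ▸ mem_singleton_self j
    rw [mem_sdiff] at hi' hj'
    have := h (S ∩ T) i j (fun h => hi'.2 (mem_inter.1 h).2) (fun h => hj'.2 (mem_inter.1 h).1)
      (fun h => hi'.2 (h ▸ hj'.1))
    rw [insert_eq, insert_eq, ← hi, ← hj, sdiff_union_inter, inter_comm S T,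
      sdiff_union_inter] at this
    exact this.mono (le_mul_of_one_le_left he (one_le_pow₀ (by norm_num)))

lemma almost_of_pairs {e : ℝ} (he : 0 ≤ e)
    (h : ∀ R i j, i ∉ R → j ∉ R → i ≠ j → P.BilinClose e (insert i R) (insert j R)) :
    P.Almost (4 ^ Fintype.card ι * e) := by
  intro S T v
  set D := P.A S (P.A T v) - P.A (S ∩ T) v with hD
  have h1 := bilinClose_of_pairs he h (2 * Fintype.card ι) S T
    (by have := card_le_univ (S \ T); have := card_le_univ (T \ S); omega) D v
  rw [pow_mul, show (2 : ℝ) ^ 2 = 4 by norm_num] at h1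
  have h2 : P.nrm D ^ 2 =
      P.E (P.A S D * P.A T v) - P.E (P.A (S ∩ T) D * P.A (S ∩ T) v) := by
    rw [nrm_sq, E_A_mul_A, ← E_mul_A, ← map_sub, ← mul_sub]
  rw [← h2] at h1
  have h3 := (le_abs_self _).trans h1
  rcases (P.nrm_nonneg D).eq_or_lt with h0 | h0
  · rw [← h0]
    have := P.nrm_nonneg v
    positivity
  · nlinarith

lemma E_A (S : Finset ι) (u : Ω → ℝ) : P.E (P.A S u) = P.E u := by
  have := P.E_mul_A S 1 u
  rwa [P.one, one_mul, one_mul] at this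

lemma A_sq_le (S : Finset ι) (u : Ω → ℝ) (x : Ω) : P.A S u x ^ 2 ≤ P.A S (u * u) x := by
  have := P.A_sum_mul_sq_le S {()} (fun _ => u) (fun _ => 1) x
  simpa [P.one] using this

lemma nrm_sqrt_A (S : Finset ι) (u : Ω → ℝ) :
    P.nrm (fun x => √(P.A S (u * u) x)) = P.nrm u := by
  refine (sq_eq_sq₀ (P.nrm_nonneg _) (P.nrm_nonneg _)).1 ?_
  rw [nrm_sq, nrm_sq, ← E_A S (u * u)]
  congr 1
  ext x
  exact Real.mul_self_sqrt (P.A_mul_self_nonneg S u x)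

end AveragingSystem

lemma marg_pos {μ : (∀ i, V i) → ℝ} (hμ : IsProb μ) (S : Finset (Fin k)) {x : ∀ i, V i}
    (hx : 0 < μ x) : 0 < marg μ S x := by
  refine sum_pos' (fun z _ => ?_) ⟨x, mem_univ _, by simpa using hx⟩
  split_ifs
  exacts [hμ.1 z, le_rfl]

lemma marg_congr (μ : (∀ i, V i) → ℝ) {S : Finset (Fin k)} {x y : ∀ i, V i}
    (h : ∀ i ∈ S, x i = y i) : marg μ S x = marg μ S y := by
  refine sum_congr rfl fun z _ => ?_
  have : (∀ i ∈ S, z i = x i) ↔ ∀ i ∈ S, z i = y i :=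
    forall₂_congr fun i hi => by rw [h i hi]
  simp only [this]

lemma cond_congr (μ : (∀ i, V i) → ℝ) {S : Finset (Fin k)} {x y : ∀ i, V i}
    (h : ∀ i ∈ S, x i = y i) : cond μ S x = cond μ S y := by
  ext z
  have : (∀ i ∈ S, z i = x i) ↔ ∀ i ∈ S, z i = y i :=
    forall₂_congr fun i hi => by rw [h i hi]
  simp only [cond, this, marg_congr μ h]

lemma eq_on_of_cond_ne_zero {μ : (∀ i, V i) → ℝ} {S : Finset (Fin k)} {x z : ∀ i, V i}
    (h : cond μ S x z ≠ 0) : ∀ i ∈ S, z i = x i := by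
  by_contra hc
  exact h (if_neg hc)

lemma cond_nonneg {μ : (∀ i, V i) → ℝ} (hμ : IsProb μ) (S : Finset (Fin k)) (x z : ∀ i, V i) :
    0 ≤ cond μ S x z := by
  unfold cond
  split_ifs
  · refine div_nonneg (hμ.1 z) (sum_nonneg fun y _ => ?_)
    split_ifs
    exacts [hμ.1 y, le_rfl]
  · exact le_rfl

lemma cond_eq_zero {μ : (∀ i, V i) → ℝ} (hμ : IsProb μ) (S : Finset (Fin k)) (x : ∀ i, V i)
    {z : ∀ i, V i} (hz : ¬ 0 < μ z) : cond μ S x z = 0 := by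
  have : μ z = 0 := le_antisymm (not_lt.1 hz) (hμ.1 z)
  simp [cond, this]

lemma sum_cond {μ : (∀ i, V i) → ℝ} (hμ : IsProb μ) (S : Finset (Fin k)) {x : ∀ i, V i}
    (hx : 0 < μ x) : ∑ z, cond μ S x z = 1 := by
  have : ∀ z, cond μ S x z = (if ∀ i ∈ S, z i = x i then μ z else 0) / marg μ S x := by
    intro z
    unfold cond
    split_ifs <;> simp
  simp_rw [this]
  rw [← sum_div]
  exact div_self (marg_pos hμ S hx).ne'

lemma mul_cond_comm (μ : (∀ i, V i) → ℝ) (S : Finset (Fin k)) (x z : ∀ i, V i) :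
    μ x * cond μ S x z = μ z * cond μ S z x := by
  by_cases h : ∀ i ∈ S, z i = x i
  · have h' : ∀ i ∈ S, x i = z i := fun i hi => (h i hi).symm
    rw [cond, cond, if_pos h, if_pos h', marg_congr μ h]
    ring
  · have h' : ¬ ∀ i ∈ S, x i = z i := fun h' => h fun i hi => (h' i hi).symm
    rw [cond, cond, if_neg h, if_neg h']
    simp

lemma cond_mul_cond (μ : (∀ i, V i) → ℝ) {S T : Finset (Fin k)} (hST : S ⊆ T)
    (x y z : ∀ i, V i) : cond μ S x z * cond μ T z y = cond μ S x y * cond μ T y z := by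
  by_cases h : ∀ i ∈ T, y i = z i
  · have h' : ∀ i ∈ T, z i = y i := fun i hi => (h i hi).symm
    have hS : (∀ i ∈ S, y i = x i) ↔ ∀ i ∈ S, z i = x i :=
      forall₂_congr fun i hi => by rw [h i (hST hi)]
    simp only [cond, if_pos h, if_pos h', hS, marg_congr μ h]
    split_ifs <;> ring
  · have h' : ¬ ∀ i ∈ T, z i = y i := fun h' => h fun i hi => (h' i hi).symm
    rw [cond, cond, cond, cond, if_neg h, if_neg h']
    simp

/-- The support of `μ`. -/
abbrev Supp (μ : (∀ i, V i) → ℝ) : Type := {x : ∀ i, V i // 0 < μ x}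

noncomputable instance (μ : (∀ i, V i) → ℝ) : Fintype (Supp μ) := Fintype.ofFinite _

omit [∀ i, DecidableEq (V i)] in
lemma sum_supp (μ g : (∀ i, V i) → ℝ) (h : ∀ x, ¬ 0 < μ x → g x = 0) :
    ∑ x : Supp μ, g x = ∑ x, g x := by
  classical
  rw [← sum_subtype (univ.filter fun x => 0 < μ x) (by simp) g]
  exact sum_filter_of_ne fun x _ hx => by_contra fun hc => hx (h x hc)

/-- Averaging of a function on the support over the link of `x`. -/
noncomputable def suppAvg (μ : (∀ i, V i) → ℝ) (S : Finset (Fin k)) (u : Supp μ → ℝ)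
    (x : ∀ i, V i) : ℝ :=
  ∑ z : Supp μ, cond μ S x z * u z

lemma suppAvg_congr {μ : (∀ i, V i) → ℝ} {S : Finset (Fin k)} (u : Supp μ → ℝ)
    {x y : ∀ i, V i} (h : ∀ i ∈ S, x i = y i) : suppAvg μ S u x = suppAvg μ S u y := by
  simp only [suppAvg, cond_congr μ h]

lemma suppAvg_eq {μ : (∀ i, V i) → ℝ} (hμ : IsProb μ) {S : Finset (Fin k)} {u : Supp μ → ℝ}
    {x : ∀ i, V i} (g : (∀ i, V i) → ℝ)
    (h : ∀ z : Supp μ, (∀ i ∈ S, z.1 i = x i) → g z = u z) :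
    suppAvg μ S u x = ∑ z, cond μ S x z * g z := by
  rw [← sum_supp μ (fun z => cond μ S x z * g z)
    fun z hz => by rw [cond_eq_zero hμ S x hz, zero_mul]]
  refine sum_congr rfl fun z _ => ?_
  by_cases hz : cond μ S x z = 0
  · simp [hz]
  · rw [h z (eq_on_of_cond_ne_zero hz)]

lemma sum_supp_cond {μ : (∀ i, V i) → ℝ} (hμ : IsProb μ) (S : Finset (Fin k)) (x : Supp μ) :
    ∑ z : Supp μ, cond μ S x z = 1 := by
  rw [sum_supp μ (cond μ S x) fun z hz => cond_eq_zero hμ S x hz, sum_cond hμ S x.2]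

/-- The averaging system on the support of a probability measure. -/
noncomputable def averagingSystem (μ : (∀ i, V i) → ℝ) (hμ : IsProb μ) :
    AveragingSystem (Fin k) (Supp μ) where
  w x := μ x
  w_nonneg x := x.2.le
  A S :=
    { toFun := fun u x => suppAvg μ S u x
      map_add' := fun u v => by ext x; simp [suppAvg, mul_add, sum_add_distrib]
      map_smul' := fun c u => by
        ext x
        simp only [suppAvg, Pi.smul_apply, smul_eq_mul, RingHom.id_apply, mul_sum]
        exact sum_congr rfl fun z _ => by ring }
  symm S u v := by
    simp only [LinearMap.coe_mk, AddHom.coe_mk, suppAvg, mul_sum, sum_mul]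
    rw [sum_comm]
    refine sum_congr rfl fun x _ => sum_congr rfl fun z _ => ?_
    linear_combination (u z * v x) * mul_cond_comm μ S z x
  nonneg S u hu x := sum_nonneg fun z _ => mul_nonneg (cond_nonneg hμ S x z) (hu z)
  one S := by
    ext x
    simpa [suppAvg] using sum_supp_cond hμ S x
  comp_of_subset S T h v := by
    ext x
    simp only [LinearMap.coe_mk, AddHom.coe_mk, suppAvg, mul_sum]
    rw [sum_comm]
    refine sum_congr rfl fun y _ => ?_
    simp_rw [← mul_assoc, cond_mul_cond μ h, mul_assoc, mul_comm _ (v y)]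
    rw [← mul_sum, ← mul_sum, sum_supp_cond hμ T y, mul_one, mul_comm]
  comp_of_superset S T h v := by
    ext x
    simp only [LinearMap.coe_mk, AddHom.coe_mk]
    rw [suppAvg_eq hμ (fun _ => suppAvg μ S v x)
      fun z hz => suppAvg_congr v fun i hi => (hz i (h hi)).symm, ← sum_mul, sum_cond hμ T x.2,
      one_mul]
  pull_out S u v := by
    ext x
    simp only [LinearMap.coe_mk, AddHom.coe_mk, Pi.mul_apply]
    rw [suppAvg, suppAvg.eq_def μ S v, mul_sum]
    refine sum_congr rfl fun z _ => ?_
    by_cases hz : cond μ S x z = 0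
    · simp [hz]
    · simp only [Pi.mul_apply, suppAvg_congr u (eq_on_of_cond_ne_zero hz)]
      ring
  univ_apply v := by
    ext x
    simp only [LinearMap.coe_mk, AddHom.coe_mk]
    have h : ∀ z : Supp μ, (∀ i ∈ univ, z.1 i = x.1 i) → v x = v z := fun z hz => by
      rw [Subtype.ext (funext fun i => hz i (mem_univ i))]
    rw [suppAvg_eq hμ (fun _ => v x) h, ← sum_mul, sum_cond hμ univ x.2, one_mul]

section

variable {μ : (∀ i, V i) → ℝ} (hμ : IsProb μ)

lemma averagingSystem_A_apply (S : Finset (Fin k)) (u : Supp μ → ℝ) (x : Supp μ) :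
    (averagingSystem μ hμ).A S u x = suppAvg μ S u x := rfl

lemma averagingSystem_E_eq (u : Supp μ → ℝ) (g : (∀ i, V i) → ℝ) (h : ∀ x : Supp μ, g x = u x) :
    (averagingSystem μ hμ).E u = ∑ x, μ x * g x := by
  rw [AveragingSystem.E_apply, ← sum_supp μ (fun x => μ x * g x) fun x hx => by
    simp [le_antisymm (not_lt.1 hx) (hμ.1 x)]]
  exact sum_congr rfl fun x _ => by rw [h]; rfl

lemma bilinClose_of_epsProduct {ε : ℝ} (hε : 0 ≤ ε) (h : EpsProduct μ ε) (R : Finset (Fin k))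
    (i j : Fin k) (hi : i ∉ R) (hj : j ∉ R) (hij : i ≠ j) :
    (averagingSystem μ hμ).BilinClose ε (insert i R) (insert j R) := by
  intro u v
  set P := averagingSystem μ hμ with hP
  have hR : R.card ≤ k - 2 := by
    have h1 := card_le_univ (insert i (insert j R))
    rw [card_insert_of_notMem (by simp [hij, hi]), card_insert_of_notMem hj,
      Fintype.card_fin] at h1
    omega
  have hR_inter : insert i R ∩ insert j R = R := by
    ext l
    simp only [mem_inter, mem_insert]
    constructor
    · rintro ⟨rfl | h1, h2 | h2⟩ <;> first | assumption | exact absurd h2 hij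
    · tauto
  rw [hR_inter]
  set U := P.A (insert i R) u with hU
  set W := P.A (insert j R) v with hW
  have hUR : P.A R U = P.A R u := P.comp_of_subset _ _ (subset_insert i R) u
  have hWR : P.A R W = P.A R v := P.comp_of_subset _ _ (subset_insert j R) v
  have key : ∀ x, |(P.A R (U * W) - P.A R u * P.A R v) x| ≤
      ε * (√(P.A R (U * U) x) * √(P.A R (W * W) x)) := by
    intro x
    set f₁ : V i → ℝ := fun a => suppAvg μ (insert i R) u (Function.update x.1 i a) with hf₁
    set f₂ : V j → ℝ := fun a => suppAvg μ (insert j R) v (Function.update x.1 j a) with hf₂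
    have g₁ : ∀ z : Supp μ, (∀ l ∈ R, z.1 l = x.1 l) → f₁ (z.1 i) = U z := by
      intro z hz
      refine suppAvg_congr u fun l hl => ?_
      by_cases e : l = i
      · subst e; simp
      · rw [Function.update_of_ne e, hz l (mem_of_mem_insert_of_ne hl e)]
    have g₂ : ∀ z : Supp μ, (∀ l ∈ R, z.1 l = x.1 l) → f₂ (z.1 j) = W z := by
      intro z hz
      refine suppAvg_congr v fun l hl => ?_
      by_cases e : l = j
      · subst e; simp
      · rw [Function.update_of_ne e, hz l (mem_of_mem_insert_of_ne hl e)]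
    have h1 := h R hR x (marg_pos hμ R x.2) i j hi hj hij f₁ f₂
    simp only [expect] at h1
    rw [← suppAvg_eq hμ (u := U * W) _ fun z hz => by simp [g₁ z hz, g₂ z hz],
      ← suppAvg_eq hμ (u := U) _ fun z hz => by simp [g₁ z hz],
      ← suppAvg_eq hμ (u := W) _ fun z hz => by simp [g₂ z hz],
      ← suppAvg_eq hμ (u := U * U) _ fun z hz => by simp [g₁ z hz, sq],
      ← suppAvg_eq hμ (u := W * W) _ fun z hz => by simp [g₂ z hz, sq]] at h1
    simp only [← averagingSystem_A_apply hμ, ← hP] at h1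
    rw [← hUR, ← hWR]
    refine h1.trans (mul_le_mul_of_nonneg_left ?_ hε)
    rw [← Real.sqrt_mul (P.A_mul_self_nonneg R U x)]
    refine Real.sqrt_le_sqrt (mul_le_mul ?_ ?_ ?_ (P.A_mul_self_nonneg R U x))
    · linarith [sq_nonneg (P.A R U x)]
    · linarith [sq_nonneg (P.A R W x)]
    · linarith [AveragingSystem.A_sq_le (P := P) R W x]
  set s : Supp μ → ℝ := fun x => √(P.A R (U * U) x) with hs
  set t : Supp μ → ℝ := fun x => √(P.A R (W * W) x) with ht
  have h2 : P.E (U * W) - P.E (P.A R u * P.A R v) =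
      P.E (P.A R (U * W) - P.A R u * P.A R v) := by
    rw [map_sub, AveragingSystem.E_A]
  have h3 : |P.E (P.A R (U * W) - P.A R u * P.A R v)| ≤ P.E (ε • (s * t)) := by
    rw [abs_le, ← map_neg]
    exact ⟨P.E_mono fun x => (abs_le.1 (key x)).1, P.E_mono fun x => (abs_le.1 (key x)).2⟩
  rw [h2]
  refine h3.trans ?_
  rw [map_smul, smul_eq_mul]
  refine mul_le_mul_of_nonneg_left ((P.E_mul_le s t).trans ?_) hε
  rw [AveragingSystem.nrm_sqrt_A, AveragingSystem.nrm_sqrt_A]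
  exact mul_le_mul (P.nrm_A_le _ u) (P.nrm_A_le _ v) (P.nrm_nonneg _) (P.nrm_nonneg _)

lemma averagingSystem_es_apply (S : Finset (Fin k)) (f : (∀ i, V i) → ℝ) (x : Supp μ) :
    (averagingSystem μ hμ).es S (fun z => f z) x = ES μ S f x := by
  rw [AveragingSystem.es_apply, Finset.sum_apply, ES]
  refine sum_congr rfl fun T _ => ?_
  rw [Pi.smul_apply, smul_eq_mul, averagingSystem_A_apply, suppAvg_eq hμ f fun _ _ => rfl, Aop]

lemma averagingSystem_low_apply (d : ℕ) (f : (∀ i, V i) → ℝ) (x : Supp μ) :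
    (∑ T ∈ AveragingSystem.low (Fin k) d, (averagingSystem μ hμ).es T fun z => f z) x =
      lowPart μ d f x := by
  simp only [Finset.sum_apply, averagingSystem_es_apply, lowPart, AveragingSystem.low,
    powerset_univ]

lemma averagingSystem_lap_apply (d : ℕ) (f : (∀ i, V i) → ℝ) (S : Finset (Fin k)) (x : Supp μ) :
    (averagingSystem μ hμ).lap d (fun z => f z) S x = LapLe μ d S f x := by
  simp only [AveragingSystem.lap, Finset.sum_apply, averagingSystem_es_apply, LapLe,
    AveragingSystem.low, powerset_univ, filter_filter, and_comm]

lemma averagingSystem_A_lap_apply (d : ℕ) (f : (∀ i, V i) → ℝ) (S : Finset (Fin k))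
    (x : Supp μ) :
    (averagingSystem μ hμ).A S ((averagingSystem μ hμ).lap d (fun z => f z) S *
      (averagingSystem μ hμ).lap d (fun z => f z) S) x = InfLe μ d S f x := by
  rw [averagingSystem_A_apply, suppAvg_eq hμ (fun z => LapLe μ d S f z ^ 2) fun z _ => by
    rw [Pi.mul_apply, averagingSystem_lap_apply, sq], InfLe]

end

omit [∀ i, DecidableEq (V i)] in
lemma abs_le_supNorm (μ f : (∀ i, V i) → ℝ) {x : ∀ i, V i} (hx : 0 < μ x) :
    |f x| ≤ supNorm μ f :=
  le_csSup (Set.toFinite _).bddAbove ⟨x, hx, rfl⟩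

omit [∀ i, Fintype (V i)] [∀ i, DecidableEq (V i)] in
lemma supNorm_nonneg (μ f : (∀ i, V i) → ℝ) : 0 ≤ supNorm μ f :=
  Real.sSup_nonneg (by rintro _ ⟨x, _, rfl⟩; exact abs_nonneg _)

theorem statement0 (k : ℕ) (hk : 1 ≤ k) :
    ∃ ε₀ C : ℝ, 0 < ε₀ ∧ 0 < C ∧
      ∀ (V : Fin k → Type) [∀ i, Fintype (V i)] [∀ i, DecidableEq (V i)]
        (μ : (∀ i, V i) → ℝ) (ε : ℝ) (d : ℕ) (f : (∀ i, V i) → ℝ),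
        0 < ε → ε ≤ ε₀ → IsProb μ → EpsProduct μ ε → d ≤ k →
        norm4p4 μ (lowPart μ d f) ≤
          20 ^ d *
              ∑ S ∈ univ.powerset.filter (fun S : Finset (Fin k) => S.card ≤ d),
                (4 * (d : ℝ)) ^ S.card * expect μ (fun x => (InfLe μ d S f x) ^ 2) +
            C * ε * normSq μ f * (supNorm μ f) ^ 2 := by
  refine ⟨1 / 4 ^ k, (7 * (2 ^ k) ^ 13 * 80 ^ k + 4 * (2 ^ k) ^ 12) * 4 ^ k, by positivity,
    by positivity, ?_⟩
  intro V _ _ μ ε d f hε hε₀ hμ hprod hd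
  set P := averagingSystem μ hμ with hP
  have hA : P.Almost (4 ^ k * ε) := by
    simpa using AveragingSystem.almost_of_pairs hε.le (bilinClose_of_epsProduct hμ hε.le hprod)
  have hδ1 : 4 ^ k * ε ≤ 1 := by
    rw [le_div_iff₀ (by positivity)] at hε₀
    linarith
  have main := AveragingSystem.nrm_low_sq_le hA (by positivity) hδ1 d (by simpa using hd)
    (f := fun z => f z) (supNorm_nonneg μ f) fun x => abs_le_supNorm μ f x.2
  have e1 : P.nrm ((∑ T ∈ AveragingSystem.low (Fin k) d, P.es T fun z => f z) *
      ∑ T ∈ AveragingSystem.low (Fin k) d, P.es T fun z => f z) ^ 2 =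
      norm4p4 μ (lowPart μ d f) := by
    rw [AveragingSystem.nrm_sq, averagingSystem_E_eq hμ _ (fun x => lowPart μ d f x ^ 4), norm4p4]
    intro x
    simp only [Pi.mul_apply, hP, averagingSystem_low_apply]
    ring
  have e2 : ∀ R, P.nrm (P.A R (P.lap d (fun z => f z) R * P.lap d (fun z => f z) R)) ^ 2 =
      expect μ (fun x => (InfLe μ d R f x) ^ 2) := by
    intro R
    rw [AveragingSystem.nrm_sq, averagingSystem_E_eq hμ _ (fun x => InfLe μ d R f x ^ 2), expect]
    intro x
    rw [Pi.mul_apply, averagingSystem_A_lap_apply, sq]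
  have e3 : P.nrm (fun z => f z) ^ 2 = normSq μ f := by
    rw [AveragingSystem.nrm_sq, averagingSystem_E_eq hμ _ (fun x => f x ^ 2), normSq]
    intro x
    rw [Pi.mul_apply, sq]
  simp only [e1, e2, mul_pow, e3, Fintype.card_fin, AveragingSystem.K] at main
  refine main.trans (add_le_add ?_ (le_of_eq (by ring)))
  rw [powerset_univ, AveragingSystem.low]
  refine mul_le_mul_of_nonneg_left (sum_le_sum fun R hR =>
    mul_le_mul_of_nonneg_right ?_ ?_) (by positivity)
  · rcases Nat.eq_zero_or_pos d with rfl | hd0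
    · have : R.card = 0 := by simpa using hR
      simp [this]
    · refine pow_le_pow_left₀ (by norm_num) ?_ _
      have : (1 : ℝ) ≤ d := by exact_mod_cast hd0
      linarith
  · exact sum_nonneg fun x _ => mul_nonneg (hμ.1 x) (sq_nonneg _)

end GLL
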